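/- Let Ω ⊂ ℝ^d be a nonempty, bounded, open set, let 0 < s < 1, 1 < p < ∞ and α, β ≥ 0. If the boundary ∂Ω is (d − sp − α − β)-homogeneous and sp + α + β = codim̲_A(∂Ω), then W_0^{s,p;α,β}(Ω) = W^{s,p;α,β}(Ω). -/

import Mathlib

open MeasureTheory Metric Set Filter
open scoped ENNReal NNReal

noncomputable section

/-- Euclidean space `ℝ^d`. -/
abbrev Rd (d : ℕ) := EuclideanSpace ℝ (Fin d)

/-- `d_Ω(x)`: the distance from `x` to the boundary `∂Ω`. -/
def distBd {d : ℕ} (Ω : Set (Rd d)) (x : Rd d) : ℝ := Metric.infDist x (frontier Ω)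

/-- The `p`-th power of the weighted Gagliardo seminorm `[f]_{W^{s,p;α,β}(Ω)}^p`, with
power-of-distance-to-the-boundary weights `d_Ω(y)^{-β} d_Ω(x)^{-α}`. -/
def gagP {d : ℕ} (Ω : Set (Rd d)) (s p α β : ℝ) (f : Rd d → ℝ) : ℝ≥0∞ :=
  ∫⁻ x in Ω, ∫⁻ y in Ω, ENNReal.ofReal
    (|f x - f y| ^ p / dist x y ^ ((d : ℝ) + s * p)
      * distBd Ω y ^ (-β) * distBd Ω x ^ (-α))

/-- The weighted Gagliardo seminorm `[f]_{W^{s,p;α,β}(Ω)}`. -/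
def gagSemi {d : ℕ} (Ω : Set (Rd d)) (s p α β : ℝ) (f : Rd d → ℝ) : ℝ≥0∞ :=
  gagP Ω s p α β f ^ (1 / p)

/-- Membership in the weighted fractional Sobolev space `W^{s,p;α,β}(Ω)`. -/
def memW {d : ℕ} (Ω : Set (Rd d)) (s p α β : ℝ) (f : Rd d → ℝ) : Prop :=
  MemLp f (ENNReal.ofReal p) (volume.restrict Ω) ∧ gagP Ω s p α β f < ⊤

/-- The norm `‖f‖_{L^p(Ω)} + [f]_{W^{s,p;α,β}(Ω)}` (as an extended real). -/
def wNorm {d : ℕ} (Ω : Set (Rd d)) (s p α β : ℝ) (f : Rd d → ℝ) : ℝ≥0∞ :=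
  eLpNorm f (ENNReal.ofReal p) (volume.restrict Ω) + gagSemi Ω s p α β f

/-- Membership in `W_0^{s,p;α,β}(Ω)`: the closure of `C_c^∞(Ω) ∩ W^{s,p;α,β}(Ω)` in
`W^{s,p;α,β}(Ω)`. -/
def memW0 {d : ℕ} (Ω : Set (Rd d)) (s p α β : ℝ) (f : Rd d → ℝ) : Prop :=
  memW Ω s p α β f ∧ ∀ ε : ℝ, 0 < ε → ∃ φ : Rd d → ℝ,
    ContDiff ℝ (⊤ : ℕ∞) φ ∧ HasCompactSupport φ ∧ tsupport φ ⊆ Ω ∧ memW Ω s p α β φ ∧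
    wNorm Ω s p α β (fun x => f x - φ x) < ENNReal.ofReal ε

/-- The defining set for the lower Assouad codimension: admissible exponents `q`. -/
def lowerCodimSet {d : ℕ} (E : Set (Rd d)) : Set ℝ :=
  {q : ℝ | 0 ≤ q ∧ ∃ C : ℝ, 1 ≤ C ∧ ∀ x ∈ E, ∀ r R : ℝ, 0 < r → r < R →
    ENNReal.ofReal R < EMetric.diam E →
    volume (Metric.cthickening r E ∩ Metric.ball x R)
      ≤ ENNReal.ofReal (C * (r / R) ^ q) * volume (Metric.ball x R)}

/-- The lower Assouad codimension. -/
def lowerCodimA {d : ℕ} (E : Set (Rd d)) : ℝ := sSup (lowerCodimSet E)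

/-- The upper Assouad codimension. -/
def upperCodimA {d : ℕ} (E : Set (Rd d)) : ℝ :=
  sInf {q : ℝ | 0 ≤ q ∧ ∃ c : ℝ, 0 < c ∧ ∀ x ∈ E, ∀ r R : ℝ, 0 < r → r < R →
    ENNReal.ofReal R < EMetric.diam E →
    ENNReal.ofReal (c * (r / R) ^ q) * volume (Metric.ball x R)
      ≤ volume (Metric.cthickening r E ∩ Metric.ball x R)}

/-- The upper Minkowski dimension. -/
def upperMinkDim {d : ℕ} (E : Set (Rd d)) : ℝ :=
  sInf {t : ℝ | 0 ≤ t ∧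
    Filter.limsup (fun r : ℝ =>
        volume (Metric.cthickening r E) * ENNReal.ofReal (r ^ (t - (d : ℝ))))
      (nhdsWithin 0 (Set.Ioi 0)) = 0}

/-- Uniform domain: any two points are joined by a `1`-Lipschitz (arc-length parameterized)
curve of length `≤ C|x-y|` staying quantitatively away from the boundary. -/
def IsUniformDomain {d : ℕ} (Ω : Set (Rd d)) : Prop :=
  ∃ C : ℝ, 1 ≤ C ∧ ∀ x ∈ Ω, ∀ y ∈ Ω, ∃ (l : ℝ) (γ : ℝ → Rd d),
    0 ≤ l ∧ l ≤ C * dist x y ∧ γ 0 = x ∧ γ l = y ∧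
    (∀ t ∈ Set.Icc 0 l, γ t ∈ Ω) ∧
    LipschitzOnWith 1 γ (Set.Icc 0 l) ∧
    ∀ t ∈ Set.Icc 0 l,
      min (dist (γ t) x) (dist (γ t) y) / C ≤ Metric.infDist (γ t) (frontier Ω)

/-- `κ`-plumpness. -/
def IsPlump {d : ℕ} (κ : ℝ) (E : Set (Rd d)) : Prop :=
  ∀ r : ℝ, 0 < r → ENNReal.ofReal r < EMetric.diam E →
    ∀ x ∈ closure E, ∃ z ∈ Metric.closedBall x r, Metric.ball z (κ * r) ⊆ E

/-- `σ`-homogeneity: `|V(E,x,λ,r)| ≤ L r^d λ^σ` where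
`V(E,x,λ,r) = {y : dist(y,E) ≤ r, |x-y| ≤ λ r}`. -/
def IsHomog {d : ℕ} (σ : ℝ) (E : Set (Rd d)) : Prop :=
  ∃ L : ℝ, 0 < L ∧ ∀ x ∈ E, ∀ lam r : ℝ, 1 ≤ lam → 0 < r →
    volume (Metric.cthickening r E ∩ Metric.closedBall x (lam * r))
      ≤ ENNReal.ofReal (L * r ^ (d : ℝ) * lam ^ σ)

/-- The axis-parallel cube with corner `a` and side length `l`. -/
def cube {d : ℕ} (a : Rd d) (l : ℝ) : Set (Rd d) :=
  {y | ∀ i, y i ∈ Set.Icc (a i) (a i + l)}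

/-- Muckenhoupt `A₁` class: `|Q|⁻¹ ∫_Q w ≤ A inf_Q w` for all cubes `Q`. -/
def IsA1 {d : ℕ} (w : Rd d → ℝ) : Prop :=
  (∀ x, 0 < w x) ∧ ∃ A : ℝ, 0 < A ∧ ∀ (a : Rd d) (l : ℝ), 0 < l →
    ∫⁻ x in cube a l, ENNReal.ofReal (w x)
      ≤ ENNReal.ofReal (A * l ^ (d : ℝ)) * ⨅ y ∈ cube a l, ENNReal.ofReal (w y)

/-- The `p`-th power of the Gagliardo seminorm with general weights `w(x) v(y)`. -/
def gagPW {d : ℕ} (Ω : Set (Rd d)) (s p : ℝ) (w v f : Rd d → ℝ) : ℝ≥0∞ :=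
  ∫⁻ x in Ω, ∫⁻ y in Ω, ENNReal.ofReal
    (|f x - f y| ^ p / dist x y ^ ((d : ℝ) + s * p) * w x * v y)

/-- Membership in `W^{s,p;w,v}(Ω)` for general weights. -/
def memWgen {d : ℕ} (Ω : Set (Rd d)) (s p : ℝ) (w v f : Rd d → ℝ) : Prop :=
  MemLp f (ENNReal.ofReal p) (volume.restrict Ω) ∧ gagPW Ω s p w v f < ⊤

/-- The norm of `W^{s,p;w,v}(Ω)` (as an extended real). -/
def wNormGen {d : ℕ} (Ω : Set (Rd d)) (s p : ℝ) (w v f : Rd d → ℝ) : ℝ≥0∞ :=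
  eLpNorm f (ENNReal.ofReal p) (volume.restrict Ω) + gagPW Ω s p w v f ^ (1 / p)

/-- Membership in `W_0^{s,p;w,v}(Ω)`. -/
def memW0gen {d : ℕ} (Ω : Set (Rd d)) (s p : ℝ) (w v f : Rd d → ℝ) : Prop :=
  memWgen Ω s p w v f ∧ ∀ ε : ℝ, 0 < ε → ∃ φ : Rd d → ℝ,
    ContDiff ℝ (⊤ : ℕ∞) φ ∧ HasCompactSupport φ ∧ tsupport φ ⊆ Ω ∧ memWgen Ω s p w v φ ∧
    wNormGen Ω s p w v (fun x => f x - φ x) < ENNReal.ofReal ε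

/-- Membership in `W_c^{s,p;w,v}(Ω)`: the closure of compactly supported measurable
functions. -/
def memWcgen {d : ℕ} (Ω : Set (Rd d)) (s p : ℝ) (w v f : Rd d → ℝ) : Prop :=
  memWgen Ω s p w v f ∧ ∀ ε : ℝ, 0 < ε → ∃ g : Rd d → ℝ,
    Measurable g ∧ HasCompactSupport g ∧ tsupport g ⊆ Ω ∧ memWgen Ω s p w v g ∧
    wNormGen Ω s p w v (fun x => f x - g x) < ENNReal.ofReal ε

end

/-! ### Generic integration lemmas -/

section Generic

variable {X : Type*} [MeasurableSpace X] {μ : Measure X} {p : ℝ}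

/-- Quasi-triangle inequality for `∫⁻ ‖·‖ₑ ^ p`. -/
theorem lintegral_enorm_rpow_add_le (hp : 1 ≤ p) {u v w : X → ℝ} (hu : Measurable u)
    (hw : ∀ x, |w x| ≤ |u x| + |v x|) :
    ∫⁻ x, ‖w x‖ₑ ^ p ∂μ ≤ 2 ^ (p - 1) * (∫⁻ x, ‖u x‖ₑ ^ p ∂μ + ∫⁻ x, ‖v x‖ₑ ^ p ∂μ) := by
  rw [← lintegral_add_left (by fun_prop), ← lintegral_const_mul' _ _ (by
    exact ENNReal.rpow_ne_top_of_nonneg (by linarith) (by simp))]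
  refine lintegral_mono fun x => ?_
  refine le_trans ?_ (ENNReal.rpow_add_le_mul_rpow_add_rpow _ _ hp)
  refine ENNReal.rpow_le_rpow ?_ (by linarith)
  rw [← ofReal_norm, ← ofReal_norm, ← ofReal_norm,
    ← ENNReal.ofReal_add (norm_nonneg _) (norm_nonneg _)]
  exact ENNReal.ofReal_le_ofReal (hw x)

/-- Dominated convergence for functions that vanish eventually at almost every point. -/
theorem tendsto_lintegral_enorm_rpow_zero (hp : 0 < p) {F : X → ℝ} {G : ℕ → X → ℝ}
    (hF : ∫⁻ x, ‖F x‖ₑ ^ p ∂μ ≠ ⊤) (hG : ∀ n, Measurable (G n))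
    (hle : ∀ n x, |G n x| ≤ |F x|) (hz : ∀ᵐ x ∂μ, ∀ᶠ n in atTop, G n x = 0) :
    Tendsto (fun n => ∫⁻ x, ‖G n x‖ₑ ^ p ∂μ) atTop (nhds 0) := by
  have h := tendsto_lintegral_of_dominated_convergence (μ := μ)
    (F := fun n x => ‖G n x‖ₑ ^ p) (f := fun _ => 0) (fun x => ‖F x‖ₑ ^ p)
    (fun n => by have := hG n; fun_prop)
    (fun n => Eventually.of_forall fun x => ENNReal.rpow_le_rpow
      (by rw [← ofReal_norm, ← ofReal_norm]; exact ENNReal.ofReal_le_ofReal (hle n x)) hp.le)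
    hF
    (by
      filter_upwards [hz] with x hx
      refine tendsto_const_nhds.congr' ?_
      filter_upwards [hx] with n hn
      simp [hn, hp])
  simpa using h

/-- A bounded sequence in `L^p` whose supports shrink to a null set has arbitrarily long sums
growing at most like `K ^ (1 / p)`. -/
theorem exists_sparse_sum_le (hp : 1 ≤ p) {F : ℕ → X → ℝ} {A : ℕ → Set X}
    (hF : ∀ n, Measurable (F n)) (hA : ∀ n, MeasurableSet (A n)) {B : ℝ≥0∞} (hB : B ≠ ⊤)
    (hFB : ∀ n, ∫⁻ x, ‖F n x‖ₑ ^ p ∂μ ≤ B) (hFA : ∀ n, ∀ x ∉ A n, F n x = 0)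
    (hAz : ∀ᵐ x ∂μ, ∀ᶠ n in atTop, x ∉ A n) (n₀ : ℕ) (K : ℕ) :
    ∃ n : ℕ → ℕ, (∀ k, n₀ ≤ n k) ∧
      ∫⁻ x, ‖∑ k ∈ Finset.range K, F (n k) x‖ₑ ^ p ∂μ ≤ K * (2 ^ (p - 1) * (1 + B)) := by
  have hp0 : 0 < p := by linarith
  have h2 : (2 : ℝ≥0∞) ^ (p - 1) ≠ ⊤ := ENNReal.rpow_ne_top_of_nonneg (by linarith) (by simp)
  induction K with
  | zero => exact ⟨fun _ => n₀, fun _ => le_rfl, by simp [hp0]⟩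
  | succ K ih =>
    obtain ⟨n, hn, hS⟩ := ih
    set S : X → ℝ := fun x => ∑ k ∈ Finset.range K, F (n k) x with hSdef
    have hSm : Measurable S := by fun_prop
    have hSfin : ∫⁻ x, ‖S x‖ₑ ^ p ∂μ ≠ ⊤ :=
      ne_top_of_le_ne_top (by finiteness) hS
    have hlim := tendsto_lintegral_enorm_rpow_zero (μ := μ) hp0 hSfin
      (G := fun m => (A m).indicator S) (fun m => hSm.indicator (hA m))
      (fun m x => by
        by_cases hx : x ∈ A m <;> simp [hx])
      (by
        filter_upwards [hAz] with x hx
        filter_upwards [hx] with m hm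
        simp [hm])
    obtain ⟨m, hm1, hm2⟩ := ((hlim.eventually (ge_mem_nhds (zero_lt_one))).and
      (eventually_ge_atTop n₀)).exists
    refine ⟨fun k => if k = K then m else n k, fun k => by
      dsimp only
      split_ifs
      exacts [hm2, hn k], ?_⟩
    have hsum : ∀ x, ∑ k ∈ Finset.range (K + 1), F (if k = K then m else n k) x
        = S x + F m x := by
      intro x
      rw [Finset.sum_range_succ]
      simp only [if_true]
      congr 1
      refine Finset.sum_congr rfl fun k hk => ?_
      rw [if_neg (Finset.mem_range.1 hk).ne]
    simp only [hsum]
    have hle : ∫⁻ x, ‖S x + F m x‖ₑ ^ p ∂μ ≤ ∫⁻ x, ‖S x‖ₑ ^ p ∂μ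
        + ∫⁻ x, ‖(A m).indicator S x + F m x‖ₑ ^ p ∂μ := by
      rw [← lintegral_add_left (by fun_prop)]
      refine lintegral_mono fun x => ?_
      by_cases hx : x ∈ A m
      · simp [hx]
      · simp [hFA m x hx]
    have hle2 := lintegral_enorm_rpow_add_le (μ := μ) hp (u := (A m).indicator S) (v := F m)
      (w := fun x => (A m).indicator S x + F m x) (hSm.indicator (hA m)) (fun x => abs_add_le _ _)
    calc _ ≤ _ := hle
      _ ≤ K * (2 ^ (p - 1) * (1 + B)) + 2 ^ (p - 1) * (1 + B) := by
        refine add_le_add hS (hle2.trans ?_)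
        gcongr
        exact hFB m
      _ = _ := by push_cast; ring

/-- Jensen's inequality for `‖·‖ₑ ^ p`. -/
theorem enorm_integral_rpow_le [IsProbabilityMeasure μ] (hp : 1 ≤ p) {φ : X → ℝ}
    (hφ : Measurable φ) : ‖∫ x, φ x ∂μ‖ₑ ^ p ≤ ∫⁻ x, ‖φ x‖ₑ ^ p ∂μ := by
  have hp0 : 0 < p := by linarith
  have h1 : (1 : ℝ≥0∞) ≤ ENNReal.ofReal p := by simpa using hp
  have h := eLpNorm_le_eLpNorm_of_exponent_le (μ := μ) h1 hφ.aestronglyMeasurable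
  rw [eLpNorm_one_eq_lintegral_enorm, eLpNorm_eq_lintegral_rpow_enorm_toReal
    (by simpa using hp0) ENNReal.ofReal_ne_top, ENNReal.toReal_ofReal hp0.le] at h
  calc ‖∫ x, φ x ∂μ‖ₑ ^ p ≤ ((∫⁻ x, ‖φ x‖ₑ ^ p ∂μ) ^ (1 / p)) ^ p :=
        ENNReal.rpow_le_rpow ((enorm_integral_le_lintegral_enorm _).trans h) hp0.le
    _ = _ := by rw [← ENNReal.rpow_mul, one_div_mul_cancel hp0.ne', ENNReal.rpow_one]

end Generic

section Translation

variable {V : Type*} [NormedAddCommGroup V] [NormedSpace ℝ V] [FiniteDimensional ℝ V]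
  [MeasurableSpace V] [BorelSpace V] (μ : Measure V) [μ.IsAddHaarMeasure] {p : ℝ}

/-- Continuity of translations in `L^p`. -/
theorem tendsto_lintegral_translate (hp : 1 ≤ p) {G : V → ℝ} (hG : Measurable G)
    (hfin : ∫⁻ v, ‖G v‖ₑ ^ p ∂μ ≠ ⊤) :
    Tendsto (fun a : V => ∫⁻ v, ‖G v - G (v + a)‖ₑ ^ p ∂μ) (nhds 0) (nhds 0) := by
  have hp0 : 0 < p := by linarith
  have hq0 : ENNReal.ofReal p ≠ 0 := by simpa using hp0
  have hqt : ENNReal.ofReal p ≠ ⊤ := ENNReal.ofReal_ne_top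
  have hqr : (ENNReal.ofReal p).toReal = p := ENNReal.toReal_ofReal hp0.le
  have : Fact (1 ≤ ENNReal.ofReal p) := ⟨by simpa using hp⟩
  have hmem : MemLp G (ENNReal.ofReal p) μ := by
    refine ⟨hG.aestronglyMeasurable, ?_⟩
    rw [eLpNorm_lt_top_iff_lintegral_rpow_enorm_lt_top hq0 hqt, hqr]
    exact hfin.lt_top
  have hmp : ∀ a : V, MeasurePreserving (fun v => v + a) μ μ :=
    fun a => measurePreserving_add_right μ a
  let g : V → C(V, V) := fun a => ⟨fun v => v + a, by fun_prop⟩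
  have hg : Continuous g := by
    have := (ContinuousMap.mk (fun z : V × V => z.2 + z.1) (by fun_prop)).curry.continuous
    exact this
  have hcont := (continuous_const (y := hmem.toLp G)).compMeasurePreservingLp hg
    (fun a => hmp a) hqt
  have h0 := ((continuous_const (y := hmem.toLp G)).edist hcont).tendsto (0 : V)
  have key : ∀ a : V, edist (hmem.toLp G) (Lp.compMeasurePreserving (g a) (hmp a) (hmem.toLp G)) ^ p
      = ∫⁻ v, ‖G v - G (v + a)‖ₑ ^ p ∂μ := by
    intro a
    rw [Lp.toLp_compMeasurePreserving (f := g a) hmem (hmp a), Lp.edist_toLp_toLp,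
      eLpNorm_eq_lintegral_rpow_enorm_toReal hq0 hqt, hqr, ← ENNReal.rpow_mul,
      one_div_mul_cancel hp0.ne', ENNReal.rpow_one]
    rfl
  have h1 := ((ENNReal.continuous_rpow_const (y := p)).tendsto _).comp h0
  simp only [Function.comp_def, key] at h1
  simpa [hp0] using h1

/-- Averages of translates converge in `L^p` as the averaging measure concentrates at `0`. -/
theorem exists_lintegral_average_translate_le {E : Type*} [NormedAddCommGroup E]
    [MeasurableSpace E] [BorelSpace E] [SecondCountableTopology E]
    (hp : 1 ≤ p) {G : V → ℝ} (hG : Measurable G)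
    (hfin : ∫⁻ v, ‖G v‖ₑ ^ p ∂μ ≠ ⊤) {i : E → V} (hi : Continuous i) (hi0 : i 0 = 0)
    {ε : ℝ≥0∞} (hε : 0 < ε) :
    ∃ r > 0, ∀ P : Measure E, IsProbabilityMeasure P → P (closedBall 0 r)ᶜ = 0 →
      ∫⁻ v, ‖∫ z, (G v - G (v + i z)) ∂P‖ₑ ^ p ∂μ ≤ ε := by
  have h := (tendsto_lintegral_translate μ hp hG hfin).comp (hi0 ▸ hi.tendsto 0)
  have h' := h.eventually (ge_mem_nhds hε)
  obtain ⟨r, hr, hball⟩ := Metric.nhds_basis_closedBall.mem_iff.1 h'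
  refine ⟨r, hr, fun P hP hP0 => ?_⟩
  have him := hi.measurable
  calc ∫⁻ v, ‖∫ z, (G v - G (v + i z)) ∂P‖ₑ ^ p ∂μ
      ≤ ∫⁻ v, ∫⁻ z, ‖G v - G (v + i z)‖ₑ ^ p ∂P ∂μ :=
        lintegral_mono fun v => enorm_integral_rpow_le hp (by fun_prop)
    _ = ∫⁻ z, ∫⁻ v, ‖G v - G (v + i z)‖ₑ ^ p ∂μ ∂P := lintegral_lintegral_swap (by
        apply Measurable.aemeasurable
        fun_prop)
    _ ≤ ∫⁻ z, ε ∂P := by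
        refine lintegral_mono_ae ?_
        have : ∀ᵐ z ∂P, z ∈ closedBall (0 : E) r := by
          rw [ae_iff]; exact hP0
        filter_upwards [this] with z hz
        exact hball hz
    _ = ε := by simp

end Translation

/-! ### The distance to the boundary -/

section Boundary

variable {d : ℕ} {Ω : Set (Rd d)}

theorem continuous_distBd : Continuous (distBd Ω) := continuous_infDist_pt _

@[fun_prop]
theorem measurable_distBd : Measurable (distBd Ω) := continuous_distBd.measurable

theorem distBd_nonneg (x : Rd d) : 0 ≤ distBd Ω x := infDist_nonneg

theorem distBd_pos (hopen : IsOpen Ω) (hfr : (frontier Ω).Nonempty) {x : Rd d} (hx : x ∈ Ω) :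
    0 < distBd Ω x := by
  refine (isClosed_frontier.notMem_iff_infDist_pos hfr).1 fun h => ?_
  rw [hopen.frontier_eq] at h
  exact h.2 hx

theorem frontier_nonempty_of_lowerCodimA_pos (h : 0 < lowerCodimA (frontier Ω)) :
    (frontier Ω).Nonempty := by
  by_contra hne
  rw [not_nonempty_iff_eq_empty] at hne
  have hset : lowerCodimSet (frontier Ω) = Ici 0 := by
    ext q
    simp only [lowerCodimSet, hne, mem_ofPred_eq, mem_Ici, and_iff_left_iff_imp]
    exact fun _ => ⟨1, le_rfl, fun x hx => absurd hx (notMem_empty x)⟩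
  rw [lowerCodimA, hset, Real.sSup_of_not_bddAbove (not_bddAbove_Ici 0)] at h
  exact lt_irrefl _ h

/-- Homogeneity of the boundary controls the volume of boundary layers. -/
theorem exists_volume_layer_le (hfr : (frontier Ω).Nonempty) (hbdd : Bornology.IsBounded Ω)
    {Q : ℝ} (hhom : IsHomog ((d : ℝ) - Q) (frontier Ω)) :
    ∃ C > 0, ∃ t₀ > 0, ∀ t, 0 < t → t ≤ t₀ →
      volume (Ω ∩ {x | distBd Ω x ≤ t}) ≤ ENNReal.ofReal (C * t ^ Q) := by
  obtain ⟨L, hL, hLb⟩ := hhom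
  obtain ⟨x₀, hx₀⟩ := hfr
  obtain ⟨D, hD, hΩD⟩ := hbdd.subset_closedBall_lt 0 x₀
  refine ⟨L * D ^ ((d : ℝ) - Q), by positivity, D, hD, fun t ht htD => ?_⟩
  have h := hLb x₀ hx₀ (D / t) t ((one_le_div ht).2 htD) ht
  rw [div_mul_cancel₀ _ ht.ne'] at h
  refine (measure_mono ?_).trans (h.trans (ENNReal.ofReal_le_ofReal (le_of_eq ?_)))
  · rintro x ⟨hx, hxt⟩
    refine ⟨?_, hΩD hx⟩
    rw [mem_cthickening_iff, ← ENNReal.ofReal_toReal (infEDist_ne_top ⟨x₀, hx₀⟩)]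
    exact ENNReal.ofReal_le_ofReal hxt
  · have e : t ^ Q = t ^ (d : ℝ) * t ^ (-((d : ℝ) - Q)) := by
      rw [← Real.rpow_add ht]
      ring_nf
    rw [Real.div_rpow hD.le ht.le, e, Real.rpow_neg ht.le]
    ring

/-- Integrals of negative powers of the distance over boundary layers. -/
theorem exists_lintegral_layer_le (hopen : IsOpen Ω) (hfr : (frontier Ω).Nonempty)
    {Q C t₀ a : ℝ} (hC : 0 < C) (ha : 0 ≤ a) (haQ : a < Q)
    (hvol : ∀ t, 0 < t → t ≤ t₀ →
      volume (Ω ∩ {x | distBd Ω x ≤ t}) ≤ ENNReal.ofReal (C * t ^ Q)) :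
    ∃ C' > 0, ∀ t, 0 < t → t ≤ t₀ →
      ∫⁻ x in Ω ∩ {x | distBd Ω x ≤ t}, ENNReal.ofReal (distBd Ω x ^ (-a))
        ≤ ENNReal.ofReal (C' * t ^ (Q - a)) := by
  set ρ : ℝ := 2⁻¹ ^ (Q - a) with hρ
  have hρ0 : 0 < ρ := by positivity
  have hρ1 : ρ < 1 := Real.rpow_lt_one (by norm_num) (by norm_num) (by linarith)
  have hsum : Summable fun j : ℕ => ρ ^ j := summable_geometric_of_lt_one hρ0.le hρ1
  refine ⟨C * 2 ^ a * ∑' j : ℕ, ρ ^ j, by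
    have := hsum.tsum_pos (fun j => by positivity) 0 (by positivity)
    positivity, fun t ht htt => ?_⟩
  set S : ℕ → Set (Rd d) := fun j =>
    Ω ∩ {x | t * 2⁻¹ ^ (j + 1) < distBd Ω x ∧ distBd Ω x ≤ t * 2⁻¹ ^ j}
  have hcover : Ω ∩ {x | distBd Ω x ≤ t} ⊆ ⋃ j, S j := by
    rintro x ⟨hx, hxt⟩
    have hx0 := distBd_pos hopen hfr hx
    have hxt' : distBd Ω x ≤ t := hxt
    obtain ⟨j, hj1, hj2⟩ := exists_nat_pow_near_of_lt_one (x := distBd Ω x / t) (y := (2⁻¹ : ℝ))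
      (by positivity) ((div_le_one ht).2 hxt') (by norm_num) (by norm_num)
    refine mem_iUnion.2 ⟨j, hx, ?_, ?_⟩
    · rw [lt_div_iff₀ ht] at hj1
      linarith
    · rw [div_le_iff₀ ht] at hj2
      linarith
  have hpiece : ∀ j, ∫⁻ x in S j, ENNReal.ofReal (distBd Ω x ^ (-a))
      ≤ ENNReal.ofReal (C * 2 ^ a * t ^ (Q - a) * ρ ^ j) := by
    intro j
    have hr : 0 < t * 2⁻¹ ^ j := by positivity
    have hr1 : t * 2⁻¹ ^ j ≤ t₀ := by
      refine le_trans (mul_le_of_le_one_right ht.le (pow_le_one₀ (by norm_num) (by norm_num))) htt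
    calc ∫⁻ x in S j, ENNReal.ofReal (distBd Ω x ^ (-a))
        ≤ ∫⁻ x in S j, ENNReal.ofReal ((t * 2⁻¹ ^ (j + 1)) ^ (-a)) := by
          refine setLIntegral_mono (by fun_prop) fun x hx => ENNReal.ofReal_le_ofReal ?_
          exact Real.rpow_le_rpow_of_nonpos (by positivity) hx.2.1.le (by linarith)
      _ = ENNReal.ofReal ((t * 2⁻¹ ^ (j + 1)) ^ (-a)) * volume (S j) := by simp
      _ ≤ ENNReal.ofReal ((t * 2⁻¹ ^ (j + 1)) ^ (-a)) * ENNReal.ofReal (C * (t * 2⁻¹ ^ j) ^ Q) := by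
          gcongr
          exact (measure_mono (inter_subset_inter_right _ fun x hx => hx.2)).trans (hvol _ hr hr1)
      _ = ENNReal.ofReal (C * 2 ^ a * t ^ (Q - a) * ρ ^ j) := by
          rw [← ENNReal.ofReal_mul (by positivity)]
          congr 1
          have e1 : t * 2⁻¹ ^ (j + 1) = 2⁻¹ * (t * 2⁻¹ ^ j) := by ring
          have e2 : ρ ^ j = (2⁻¹ ^ j) ^ (Q - a) := by
            rw [hρ, ← Real.rpow_natCast, ← Real.rpow_mul (by norm_num), mul_comm,
              Real.rpow_mul (by norm_num), Real.rpow_natCast]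
          rw [e1, e2, mul_assoc (C * 2 ^ a), ← Real.mul_rpow ht.le (by positivity),
            Real.mul_rpow (by norm_num) hr.le, Real.inv_rpow (by norm_num),
            Real.rpow_neg (by norm_num), inv_inv, sub_eq_add_neg, Real.rpow_add hr]
          ring
  calc ∫⁻ x in Ω ∩ {x | distBd Ω x ≤ t}, ENNReal.ofReal (distBd Ω x ^ (-a))
      ≤ ∫⁻ x in ⋃ j, S j, ENNReal.ofReal (distBd Ω x ^ (-a)) := lintegral_mono_set hcover
    _ ≤ ∑' j, ∫⁻ x in S j, ENNReal.ofReal (distBd Ω x ^ (-a)) := lintegral_iUnion_le _ _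
    _ ≤ ∑' j, ENNReal.ofReal (C * 2 ^ a * t ^ (Q - a) * ρ ^ j) := ENNReal.tsum_le_tsum hpiece
    _ = _ := by
        rw [← ENNReal.ofReal_tsum_of_nonneg (fun j => by positivity) (hsum.mul_left _),
          tsum_mul_left]
        congr 1
        ring

/-- Negative powers of the distance are integrable below the codimension. -/
theorem lintegral_distBd_rpow_ne_top (hopen : IsOpen Ω) (hfr : (frontier Ω).Nonempty)
    (hbdd : Bornology.IsBounded Ω) {Q C t₀ a : ℝ} (hC : 0 < C) (ht₀ : 0 < t₀) (ha : 0 ≤ a)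
    (haQ : a < Q) (hvol : ∀ t, 0 < t → t ≤ t₀ →
      volume (Ω ∩ {x | distBd Ω x ≤ t}) ≤ ENNReal.ofReal (C * t ^ Q)) :
    ∫⁻ x in Ω, ENNReal.ofReal (distBd Ω x ^ (-a)) ≠ ⊤ := by
  obtain ⟨C', -, hC'⟩ := exists_lintegral_layer_le hopen hfr hC ha haQ hvol
  have hms : MeasurableSet {x | distBd Ω x ≤ t₀} := measurableSet_le (by fun_prop) (by fun_prop)
  rw [← lintegral_inter_add_sdiff _ Ω hms]
  refine ENNReal.add_ne_top.2 ⟨ne_top_of_le_ne_top ENNReal.ofReal_ne_top (hC' t₀ ht₀ le_rfl), ?_⟩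
  have : ∫⁻ x in Ω \ {x | distBd Ω x ≤ t₀}, ENNReal.ofReal (distBd Ω x ^ (-a))
      ≤ ∫⁻ x in Ω \ {x | distBd Ω x ≤ t₀}, ENNReal.ofReal (t₀ ^ (-a)) := by
    refine setLIntegral_mono (by fun_prop) fun x hx => ENNReal.ofReal_le_ofReal ?_
    exact Real.rpow_le_rpow_of_nonpos ht₀ (not_le.1 hx.2).le (by linarith)
  refine ne_top_of_le_ne_top ?_ this
  rw [setLIntegral_const]
  exact ENNReal.mul_ne_top ENNReal.ofReal_ne_top
    (hbdd.subset sdiff_subset).measure_lt_top.ne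

end Boundary

/-! ### The truncated kernel -/

section Kernel

variable {d : ℕ}

/-- The kernel `min(1, |k| / t) ^ p / |k| ^ (d + sp)`. -/
noncomputable def truncKernel (s p t : ℝ) (k : Rd d) : ℝ := min 1 (‖k‖ / t) ^ p / ‖k‖ ^ ((d : ℝ) + s * p)

theorem integrable_truncKernel_one [Nontrivial (Rd d)] {s p : ℝ} (hs0 : 0 < s) (hs1 : s < 1)
    (hp : 0 < p) : Integrable (truncKernel (d := d) s p 1) := by
  have hd : 0 < d := by
    rcases Nat.eq_zero_or_pos d with rfl | h
    · exact absurd ‹Nontrivial (Rd 0)› (not_nontrivial _)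
    · exact h
  have hsp : 0 < s * p := by positivity
  have hspp : s * p < p := by nlinarith
  have heq : truncKernel (d := d) s p 1
      = fun k => (fun r : ℝ => min 1 r ^ p / r ^ ((d : ℝ) + s * p)) ‖k‖ := by
    ext k; simp [truncKernel]
  rw [heq, integrable_fun_norm_addHaar volume (f := fun r : ℝ => min 1 r ^ p / r ^ ((d : ℝ) + s * p)),
    finrank_euclideanSpace_fin, ← Ioc_union_Ioi_eq_Ioi (zero_le_one' ℝ), integrableOn_union]
  constructor
  · have h1 : IntegrableOn (fun r : ℝ => r ^ (p - s * p - 1)) (Ioc 0 1) :=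
      (intervalIntegral.intervalIntegrable_rpow' (by linarith)).1
    refine h1.congr_fun (fun r hr => ?_) measurableSet_Ioc
    simp only [smul_eq_mul, min_eq_right hr.2]
    rw [← Real.rpow_natCast, Nat.cast_sub hd, ← Real.rpow_sub hr.1, ← Real.rpow_add hr.1]
    congr 1; push_cast; ring
  · have h1 : IntegrableOn (fun r : ℝ => r ^ (-s * p - 1)) (Ioi 1) :=
      integrableOn_Ioi_rpow_of_lt (by linarith) one_pos
    refine h1.congr_fun (fun r hr => ?_) measurableSet_Ioi
    have hr' : (1 : ℝ) < r := hr
    have hr0 : 0 < r := by linarith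
    simp only [smul_eq_mul, min_eq_left hr'.le, Real.one_rpow]
    rw [← Real.rpow_natCast, Nat.cast_sub hd, one_div, ← Real.rpow_neg hr0.le, ← Real.rpow_add hr0]
    congr 1; push_cast; ring

@[fun_prop]
theorem measurable_truncKernel {s p t : ℝ} : Measurable (truncKernel (d := d) s p t) := by
  unfold truncKernel
  fun_prop

theorem exists_lintegral_truncKernel_le [Nontrivial (Rd d)] {s p : ℝ} (hs0 : 0 < s) (hs1 : s < 1)
    (hp : 0 < p) : ∃ C > 0, ∀ t, 0 < t →
      ∫⁻ k, ENNReal.ofReal (truncKernel (d := d) s p t k) ≤ ENNReal.ofReal (C * t ^ (-(s * p))) := by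
  have hfin := (integrable_truncKernel_one (d := d) hs0 hs1 hp).lintegral_lt_top
  set I := ∫⁻ k, ENNReal.ofReal (truncKernel (d := d) s p 1 k) with hI
  refine ⟨I.toReal + 1, by positivity, fun t ht => ?_⟩
  have hscale : ∀ k : Rd d, ENNReal.ofReal (truncKernel s p t k)
      = ENNReal.ofReal (t ^ (-((d : ℝ) + s * p)))
        * ENNReal.ofReal (truncKernel s p 1 (t⁻¹ • k)) := by
    intro k
    rw [← ENNReal.ofReal_mul (by positivity)]
    congr 1
    simp only [truncKernel, norm_smul, norm_inv, Real.norm_of_nonneg ht.le, div_one]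
    rw [Real.mul_rpow (by positivity) (norm_nonneg _), Real.inv_rpow ht.le, Real.rpow_neg ht.le,
      inv_mul_eq_div, inv_mul_eq_div]
    have : 0 < t ^ ((d : ℝ) + s * p) := by positivity
    field_simp
  simp only [hscale]
  rw [lintegral_const_mul _ (by fun_prop)]
  have hmap : ∫⁻ k : Rd d, ENNReal.ofReal (truncKernel s p 1 (t⁻¹ • k))
      = ENNReal.ofReal (t ^ (d : ℝ)) * I := by
    rw [hI, ← lintegral_map (f := fun k => ENNReal.ofReal (truncKernel (d := d) s p 1 k))
      (g := fun k : Rd d => t⁻¹ • k) (by fun_prop) (by fun_prop),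
      Measure.map_addHaar_smul volume (inv_ne_zero ht.ne'), lintegral_smul_measure,
      finrank_euclideanSpace_fin, inv_pow, inv_inv, abs_of_pos (by positivity), Real.rpow_natCast,
      smul_eq_mul]
  rw [hmap, ← mul_assoc, ← ENNReal.ofReal_mul (by positivity), ← Real.rpow_add ht,
    ← ENNReal.ofReal_toReal hfin.ne, ← ENNReal.ofReal_mul (by positivity),
    ENNReal.toReal_ofReal ENNReal.toReal_nonneg]
  refine ENNReal.ofReal_le_ofReal ?_
  have e : -((d : ℝ) + s * p) + d = -(s * p) := by ring
  rw [e]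
  have : 0 < t ^ (-(s * p)) := by positivity
  nlinarith

end Kernel

/-! ### The Gagliardo energy as an integral over the product -/

section Energy

variable {d : ℕ} {Ω : Set (Rd d)} {s p α β : ℝ}

/-- The weight of the Gagliardo seminorm. -/
noncomputable def gagWeight (Ω : Set (Rd d)) (s p α β : ℝ) (z : Rd d × Rd d) : ℝ≥0∞ :=
  ENNReal.ofReal ((dist z.1 z.2 ^ ((d : ℝ) + s * p))⁻¹
    * distBd Ω z.2 ^ (-β) * distBd Ω z.1 ^ (-α))

/-- The measure on `Ω × Ω` underlying the Gagliardo seminorm. -/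
noncomputable def gagMeasure (Ω : Set (Rd d)) (s p α β : ℝ) : Measure (Rd d × Rd d) :=
  (volume.restrict (Ω ×ˢ Ω)).withDensity (gagWeight Ω s p α β)

/-- The sum of the `p`-th powers of the `L^p` norm and of the Gagliardo seminorm. -/
noncomputable def gagEnergy (Ω : Set (Rd d)) (s p α β : ℝ) (u : Rd d → ℝ) : ℝ≥0∞ :=
  (∫⁻ x in Ω, ‖u x‖ₑ ^ p) + ∫⁻ z, ‖u z.1 - u z.2‖ₑ ^ p ∂gagMeasure Ω s p α β

@[fun_prop]
theorem measurable_gagWeight : Measurable (gagWeight Ω s p α β) := by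
  unfold gagWeight
  fun_prop

theorem lintegral_gagMeasure {g : Rd d × Rd d → ℝ≥0∞} (hg : Measurable g) :
    ∫⁻ z, g z ∂gagMeasure Ω s p α β = ∫⁻ z in Ω ×ˢ Ω, gagWeight Ω s p α β z * g z := by
  rw [gagMeasure, lintegral_withDensity_eq_lintegral_mul _ measurable_gagWeight hg]
  rfl

theorem ae_gagMeasure_mem (hopen : IsOpen Ω) :
    ∀ᵐ z ∂gagMeasure Ω s p α β, z.1 ∈ Ω ∧ z.2 ∈ Ω :=
  (withDensity_absolutelyContinuous _ _).ae_le
    (ae_restrict_mem (hopen.measurableSet.prod hopen.measurableSet))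

theorem setLIntegral_prod_self {g : Rd d × Rd d → ℝ≥0∞} (hg : Measurable g) :
    ∫⁻ z in Ω ×ˢ Ω, g z = ∫⁻ x in Ω, ∫⁻ y in Ω, g (x, y) := by
  rw [Measure.volume_eq_prod, ← Measure.prod_restrict, lintegral_prod _ hg.aemeasurable]

theorem gagP_eq_lintegral (hp : 0 < p) {u : Rd d → ℝ} (hu : Measurable u) :
    gagP Ω s p α β u = ∫⁻ z, ‖u z.1 - u z.2‖ₑ ^ p ∂gagMeasure Ω s p α β := by
  rw [lintegral_gagMeasure (by fun_prop), setLIntegral_prod_self (by fun_prop), gagP]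
  refine lintegral_congr fun x => lintegral_congr fun y => ?_
  rw [← ofReal_norm, Real.norm_eq_abs, ENNReal.ofReal_rpow_of_nonneg (abs_nonneg _) hp.le,
    gagWeight, mul_comm (ENNReal.ofReal _), ← ENNReal.ofReal_mul (by positivity)]
  congr 1
  simp only [div_eq_mul_inv]
  ring

theorem gagEnergy_add_le (hp : 1 ≤ p) {u v : Rd d → ℝ} (hu : Measurable u) :
    gagEnergy Ω s p α β (fun x => u x + v x)
      ≤ 2 ^ (p - 1) * (gagEnergy Ω s p α β u + gagEnergy Ω s p α β v) := by
  have h1 := lintegral_enorm_rpow_add_le (μ := volume.restrict Ω) hp (u := u) (v := v)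
    (w := fun x => u x + v x) hu (fun x => abs_add_le _ _)
  have h2 := lintegral_enorm_rpow_add_le (μ := gagMeasure Ω s p α β) hp
    (u := fun z => u z.1 - u z.2) (v := fun z => v z.1 - v z.2)
    (w := fun z => (u z.1 + v z.1) - (u z.2 + v z.2)) (by fun_prop) (fun z => by
      rw [add_sub_add_comm]; exact abs_add_le _ _)
  refine (add_le_add h1 h2).trans (le_of_eq ?_)
  unfold gagEnergy
  ring

theorem gagEnergy_sub_le (hp : 1 ≤ p) {u v : Rd d → ℝ} (hu : Measurable u) :
    gagEnergy Ω s p α β (fun x => u x - v x)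
      ≤ 2 ^ (p - 1) * (gagEnergy Ω s p α β u + gagEnergy Ω s p α β v) := by
  have hneg : gagEnergy Ω s p α β (fun x => -v x) = gagEnergy Ω s p α β v := by
    have e : ∀ z : Rd d × Rd d, -v z.1 - -v z.2 = -(v z.1 - v z.2) := fun z => by ring
    simp only [gagEnergy, e, enorm_neg]
  simpa only [sub_eq_add_neg, hneg] using gagEnergy_add_le (Ω := Ω) (s := s) (α := α) (β := β) hp
    (v := fun x => -v x) hu

/-- Truncations approximate a function of finite energy. -/
theorem exists_bounded_gagEnergy_sub_le (hp : 1 ≤ p) {u : Rd d → ℝ} (hu : Measurable u)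
    (hfin : gagEnergy Ω s p α β u ≠ ⊤) {ε : ℝ≥0∞} (hε : 0 < ε) :
    ∃ v : Rd d → ℝ, Measurable v ∧ (∃ M : ℝ, ∀ x, |v x| ≤ M) ∧ (∀ x, u x = 0 → v x = 0) ∧
      gagEnergy Ω s p α β v ≠ ⊤ ∧ gagEnergy Ω s p α β (fun x => u x - v x) ≤ ε := by
  have hp0 : 0 < p := by linarith
  set c : ℕ → ℝ → ℝ := fun n r => max (-n) (min r n) with hc
  have hcm : ∀ n, Measurable (c n) := fun n => by fun_prop
  have hclip : ∀ n a b, |c n a - c n b| ≤ |a - b| := by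
    intro n a b
    refine (abs_max_sub_max_le_max _ _ _ _).trans ?_
    simpa using (abs_min_sub_min_le_max a (n : ℝ) b n)
  have hrest : ∀ n a b, |(a - c n a) - (b - c n b)| ≤ |a - b| := by
    intro n a b
    wlog hab : a ≤ b generalizing a b
    · rw [abs_sub_comm, abs_sub_comm a b]
      exact this b a (le_of_not_ge hab)
    have hmono : c n a ≤ c n b := max_le_max_left _ (min_le_min_right _ hab)
    have h1 := hclip n a b
    rw [abs_of_nonpos (by linarith : a - b ≤ 0), abs_of_nonpos (by linarith)] at h1
    rw [abs_of_nonpos (by linarith : a - b ≤ 0), abs_of_nonpos (by linarith)]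
    linarith
  have hc0 : ∀ n, c n 0 = 0 := fun n => by simp [hc]
  have hev : ∀ a : ℝ, ∀ᶠ n in atTop, a - c n a = 0 := by
    intro a
    obtain ⟨N, hN⟩ := exists_nat_ge |a|
    filter_upwards [eventually_ge_atTop N] with n hn
    have : |a| ≤ n := hN.trans (by exact_mod_cast hn)
    obtain ⟨h1, h2⟩ := abs_le.1 this
    simp [hc, h1, h2]
  have hfin' := hfin
  rw [gagEnergy, ENNReal.add_ne_top] at hfin'
  have t1 := tendsto_lintegral_enorm_rpow_zero (μ := volume.restrict Ω) hp0 hfin'.1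
    (G := fun n x => u x - c n (u x)) (fun n => by fun_prop)
    (fun n x => by simpa [hc0] using hrest n (u x) 0) (Eventually.of_forall fun x => hev _)
  have t2 := tendsto_lintegral_enorm_rpow_zero (μ := gagMeasure Ω s p α β) hp0 hfin'.2
    (G := fun n z => (u z.1 - c n (u z.1)) - (u z.2 - c n (u z.2))) (fun n => by fun_prop)
    (fun n z => hrest n _ _) (Eventually.of_forall fun z => by
      filter_upwards [hev (u z.1), hev (u z.2)] with n h1 h2
      rw [h1, h2, sub_zero])
  have t := t1.add t2
  rw [add_zero] at t
  obtain ⟨n, hn⟩ := (t.eventually (ge_mem_nhds hε)).exists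
  refine ⟨fun x => c n (u x), by fun_prop, ⟨n, fun x => ?_⟩,
    fun x hx => by simp only [hx, hc0], ?_, hn⟩
  · rw [abs_le]
    exact ⟨le_max_left _ _, max_le (by linarith [n.cast_nonneg (α := ℝ)]) (min_le_right _ _)⟩
  · refine ne_top_of_le_ne_top hfin (add_le_add (lintegral_mono fun x => ?_)
      (lintegral_mono fun z => ?_))
    · refine ENNReal.rpow_le_rpow ?_ hp0.le
      rw [← ofReal_norm, ← ofReal_norm]
      exact ENNReal.ofReal_le_ofReal (by simpa [hc0] using hclip n (u x) 0)
    · refine ENNReal.rpow_le_rpow ?_ hp0.le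
      rw [← ofReal_norm, ← ofReal_norm]
      exact ENNReal.ofReal_le_ofReal (hclip n _ _)

/-! ### Cutoff functions -/

/-- The cutoff that vanishes where `d_Ω ≤ t` and equals `1` where `d_Ω ≥ 2t`. -/
noncomputable def bdCutoff (Ω : Set (Rd d)) (t : ℝ) (x : Rd d) : ℝ :=
  max 0 (min 1 (distBd Ω x / t - 1))

@[fun_prop]
theorem measurable_bdCutoff {t : ℝ} : Measurable (bdCutoff Ω t) := by
  unfold bdCutoff
  fun_prop

theorem bdCutoff_nonneg (t : ℝ) (x : Rd d) : 0 ≤ bdCutoff Ω t x := le_max_left _ _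

theorem bdCutoff_le_one (t : ℝ) (x : Rd d) : bdCutoff Ω t x ≤ 1 :=
  max_le zero_le_one (min_le_left _ _)

theorem bdCutoff_eq_zero {t : ℝ} (ht : 0 < t) {x : Rd d} (hx : distBd Ω x ≤ t) :
    bdCutoff Ω t x = 0 := by
  refine max_eq_left ((min_le_right _ _).trans ?_)
  rw [sub_nonpos]
  exact (div_le_one ht).2 hx

theorem bdCutoff_eq_one {t : ℝ} (ht : 0 < t) {x : Rd d} (hx : 2 * t ≤ distBd Ω x) :
    bdCutoff Ω t x = 1 := by
  have : 2 ≤ distBd Ω x / t := (le_div_iff₀ ht).2 hx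
  rw [bdCutoff, min_eq_left (by linarith), max_eq_right zero_le_one]

theorem abs_bdCutoff_sub_le {t : ℝ} (ht : 0 < t) (x y : Rd d) :
    |bdCutoff Ω t x - bdCutoff Ω t y| ≤ min 1 (‖y - x‖ / t) := by
  refine le_min ?_ ?_
  · rw [abs_le]
    constructor <;> linarith [bdCutoff_nonneg (Ω := Ω) t x, bdCutoff_nonneg (Ω := Ω) t y,
      bdCutoff_le_one (Ω := Ω) t x, bdCutoff_le_one (Ω := Ω) t y]
  · have h1 : |distBd Ω x - distBd Ω y| ≤ ‖y - x‖ := by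
      rw [← dist_eq_norm, dist_comm, ← Real.dist_eq]
      simpa [distBd] using (lipschitz_infDist_pt (frontier Ω)).dist_le_mul x y
    have h2 : |bdCutoff Ω t x - bdCutoff Ω t y|
        ≤ |(distBd Ω x / t - 1) - (distBd Ω y / t - 1)| := by
      refine (abs_max_sub_max_le_max _ _ _ _).trans ?_
      simpa using abs_min_sub_min_le_max 1 (distBd Ω x / t - 1) 1 (distBd Ω y / t - 1)
    refine h2.trans ?_
    rw [sub_sub_sub_cancel_right, ← sub_div, abs_div, abs_of_pos ht]
    gcongr

/-- A majorant for the energy density of the cutoff near the boundary. -/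
noncomputable def layerKernel (Ω : Set (Rd d)) (s p a b t : ℝ) (z : Rd d × Rd d) : ℝ≥0∞ :=
  {x | distBd Ω x ≤ 2 * t}.indicator (fun x => ENNReal.ofReal (distBd Ω x ^ (-a))) z.1
    * (ENNReal.ofReal (t ^ (-b)) * ENNReal.ofReal (truncKernel s p t (z.2 - z.1)))

theorem measurable_layerKernel {a b t : ℝ} : Measurable (layerKernel Ω s p a b t) := by
  have hms : MeasurableSet {x | distBd Ω x ≤ 2 * t} :=
    measurableSet_le (by fun_prop) (by fun_prop)
  have : Measurable ({x | distBd Ω x ≤ 2 * t}.indicator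
      fun x => ENNReal.ofReal (distBd Ω x ^ (-a))) := Measurable.indicator (by fun_prop) hms
  unfold layerKernel
  fun_prop

theorem exists_lintegral_layerKernel_le (hopen : IsOpen Ω) (hne : Ω.Nonempty)
    (hfr : (frontier Ω).Nonempty) (hs0 : 0 < s) (hs1 : s < 1) (hp : 0 < p)
    {a b C t₀ : ℝ} (hC : 0 < C) (ha : 0 ≤ a) (hb : 0 ≤ b)
    (hvol : ∀ t, 0 < t → t ≤ t₀ →
      volume (Ω ∩ {x | distBd Ω x ≤ t}) ≤ ENNReal.ofReal (C * t ^ (s * p + a + b))) :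
    ∃ B : ℝ≥0∞, B ≠ ⊤ ∧ ∀ t, 0 < t → 2 * t ≤ t₀ →
      ∫⁻ z in Ω ×ˢ Ω, layerKernel Ω s p a b t z ≤ B := by
  have hsp : 0 < s * p := by positivity
  have : Nontrivial (Rd d) := by
    obtain ⟨x, hx⟩ := hne
    obtain ⟨y, hy⟩ := hfr
    refine ⟨x, y, ?_⟩
    rintro rfl
    rw [hopen.frontier_eq] at hy
    exact hy.2 hx
  obtain ⟨C₁, hC₁, h1⟩ := exists_lintegral_layer_le hopen hfr hC ha (by linarith) hvol
  obtain ⟨C₂, hC₂, h2⟩ := exists_lintegral_truncKernel_le (d := d) hs0 hs1 hp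
  refine ⟨ENNReal.ofReal (C₁ * 2 ^ (s * p + b) * C₂), ENNReal.ofReal_ne_top, fun t ht htt => ?_⟩
  have hms : MeasurableSet {x | distBd Ω x ≤ 2 * t} :=
    measurableSet_le (by fun_prop) (by fun_prop)
  have hind : Measurable ({x | distBd Ω x ≤ 2 * t}.indicator
      fun x => ENNReal.ofReal (distBd Ω x ^ (-a))) := Measurable.indicator (by fun_prop) hms
  rw [setLIntegral_prod_self measurable_layerKernel]
  calc ∫⁻ x in Ω, ∫⁻ y in Ω, layerKernel Ω s p a b t (x, y)
      ≤ ∫⁻ x in Ω, {x | distBd Ω x ≤ 2 * t}.indicator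
          (fun x => ENNReal.ofReal (distBd Ω x ^ (-a))) x
          * (ENNReal.ofReal (t ^ (-b)) * ENNReal.ofReal (C₂ * t ^ (-(s * p)))) := by
        refine lintegral_mono fun x => ?_
        simp only [layerKernel]
        rw [lintegral_const_mul _ (by fun_prop), lintegral_const_mul _ (by fun_prop)]
        gcongr
        refine (setLIntegral_le_lintegral _ _).trans ?_
        rw [lintegral_sub_right_eq_self (fun k => ENNReal.ofReal (truncKernel s p t k)) x]
        exact h2 t ht
    _ = (∫⁻ x in Ω ∩ {x | distBd Ω x ≤ 2 * t}, ENNReal.ofReal (distBd Ω x ^ (-a)))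
          * (ENNReal.ofReal (t ^ (-b)) * ENNReal.ofReal (C₂ * t ^ (-(s * p)))) := by
        rw [lintegral_mul_const _ hind, lintegral_indicator hms, Measure.restrict_restrict hms,
          inter_comm]
    _ ≤ ENNReal.ofReal (C₁ * (2 * t) ^ (s * p + a + b - a))
          * (ENNReal.ofReal (t ^ (-b)) * ENNReal.ofReal (C₂ * t ^ (-(s * p)))) := by
        gcongr
        exact h1 _ (by positivity) htt
    _ = _ := by
        rw [← ENNReal.ofReal_mul (by positivity), ← ENNReal.ofReal_mul (by positivity)]
        congr 1
        have e : s * p + a + b - a = s * p + b := by ring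
        have e2 : t ^ (s * p + b) * (t ^ (-b) * t ^ (-(s * p))) = 1 := by
          rw [← Real.rpow_add ht, ← Real.rpow_add ht]
          ring_nf
          exact Real.rpow_zero _
        rw [e, Real.mul_rpow (by norm_num) ht.le]
        linear_combination (C₁ * 2 ^ (s * p + b) * C₂) * e2

/-- The energies of the cutoffs are uniformly bounded. -/
theorem exists_lintegral_bdCutoff_le (hopen : IsOpen Ω) (hne : Ω.Nonempty)
    (hfr : (frontier Ω).Nonempty) (hs0 : 0 < s) (hs1 : s < 1) (hp : 0 < p)
    {C t₀ : ℝ} (hC : 0 < C) (hα : 0 ≤ α) (hβ : 0 ≤ β)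
    (hvol : ∀ t, 0 < t → t ≤ t₀ →
      volume (Ω ∩ {x | distBd Ω x ≤ t}) ≤ ENNReal.ofReal (C * t ^ (s * p + α + β))) :
    ∃ B : ℝ≥0∞, B ≠ ⊤ ∧ ∀ t, 0 < t → 2 * t ≤ t₀ →
      ∫⁻ z, ‖bdCutoff Ω t z.1 - bdCutoff Ω t z.2‖ₑ ^ p ∂gagMeasure Ω s p α β ≤ B := by
  obtain ⟨B₁, hB₁, h1⟩ := exists_lintegral_layerKernel_le hopen hne hfr hs0 hs1 hp hC hα hβ hvol
  obtain ⟨B₂, hB₂, h2⟩ := exists_lintegral_layerKernel_le hopen hne hfr hs0 hs1 hp hC hβ hα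
    (by simpa only [add_right_comm] using hvol)
  refine ⟨B₁ + B₂, ENNReal.add_ne_top.2 ⟨hB₁, hB₂⟩, fun t ht htt => ?_⟩
  rw [lintegral_gagMeasure (by fun_prop)]
  have hswap : ∫⁻ z in Ω ×ˢ Ω, layerKernel Ω s p β α t z.swap
      = ∫⁻ z in Ω ×ˢ Ω, layerKernel Ω s p β α t z := by
    rw [Measure.volume_eq_prod, ← Measure.prod_restrict, lintegral_prod_swap]
  refine le_trans ?_ (add_le_add (h1 t ht htt) (hswap ▸ h2 t ht htt))
  rw [← lintegral_add_left measurable_layerKernel]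
  refine setLIntegral_mono (by
    have := measurable_layerKernel (Ω := Ω) (s := s) (p := p) (a := β) (b := α) (t := t)
    exact measurable_layerKernel.add (this.comp measurable_swap)) ?_
  rintro ⟨x, y⟩ ⟨hx, hy⟩
  have hx0 := distBd_pos hopen hfr hx
  have hy0 := distBd_pos hopen hfr hy
  have hker : ∀ v w : Rd d, ‖bdCutoff Ω t v - bdCutoff Ω t w‖ₑ ^ p
      * ENNReal.ofReal ((dist v w ^ ((d : ℝ) + s * p))⁻¹)
      ≤ ENNReal.ofReal (truncKernel s p t (w - v)) := by
    intro v w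
    rw [← ofReal_norm, ENNReal.ofReal_rpow_of_nonneg (norm_nonneg _) hp.le,
      ← ENNReal.ofReal_mul (by positivity), truncKernel, div_eq_mul_inv, dist_comm, dist_eq_norm]
    gcongr
    exact abs_bdCutoff_sub_le ht v w
  -- the estimate when `v` is close to the boundary and `w` is not too close
  have hmain : ∀ (v w : Rd d) (a b : ℝ), 0 ≤ b → distBd Ω v ≤ 2 * t → t ≤ distBd Ω w →
      ENNReal.ofReal ((dist v w ^ ((d : ℝ) + s * p))⁻¹ * distBd Ω w ^ (-b) * distBd Ω v ^ (-a))
        * ‖bdCutoff Ω t v - bdCutoff Ω t w‖ₑ ^ p ≤ layerKernel Ω s p a b t (v, w) := by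
    intro v w a b hb hv hw
    have hv0 := distBd_nonneg (Ω := Ω) v
    have hw0 := distBd_nonneg (Ω := Ω) w
    rw [layerKernel, indicator_of_mem (show v ∈ {x | distBd Ω x ≤ 2 * t} from hv),
      ENNReal.ofReal_mul (by positivity), ENNReal.ofReal_mul (by positivity)]
    calc _ = ENNReal.ofReal (distBd Ω v ^ (-a)) * (ENNReal.ofReal (distBd Ω w ^ (-b)) *
          (‖bdCutoff Ω t v - bdCutoff Ω t w‖ₑ ^ p
            * ENNReal.ofReal ((dist v w ^ ((d : ℝ) + s * p))⁻¹))) := by ring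
      _ ≤ _ := by
        refine mul_le_mul' le_rfl (mul_le_mul' (ENNReal.ofReal_le_ofReal ?_) ?_)
        · exact Real.rpow_le_rpow_of_nonpos ht hw (by linarith)
        · exact hker v w
  by_cases hA : distBd Ω x ≤ 2 * t ∧ t ≤ distBd Ω y
  · exact (hmain x y α β hβ hA.1 hA.2).trans le_self_add
  by_cases hB : distBd Ω y ≤ 2 * t ∧ t ≤ distBd Ω x
  · refine le_trans (le_of_eq ?_) ((hmain y x β α hα hB.1 hB.2).trans le_add_self)
    simp only [gagWeight]
    rw [dist_comm y x, ← enorm_neg, neg_sub, mul_right_comm]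
  have hzero : bdCutoff Ω t x = bdCutoff Ω t y := by
    rcases le_total (distBd Ω x) t with h | h
    · rw [bdCutoff_eq_zero ht h, bdCutoff_eq_zero ht]
      by_contra hcon
      exact hA ⟨by linarith, (not_le.1 hcon).le⟩
    · have hy2 : 2 * t ≤ distBd Ω y := by
        by_contra hcon
        exact hB ⟨(not_le.1 hcon).le, h⟩
      rw [bdCutoff_eq_one ht hy2, bdCutoff_eq_one ht]
      by_contra hcon
      exact hA ⟨(not_le.1 hcon).le, by linarith⟩
  simp [hzero, hp]

end Energy

/-! ### Approximation by functions supported away from the boundary -/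

section Support

variable {d : ℕ} {Ω : Set (Rd d)} {s p α β : ℝ}

/-- A bounded function of finite energy is approximated by functions vanishing near the boundary,
obtained by multiplication with averages of sparse sequences of cutoffs. -/
theorem exists_supported_gagEnergy_sub_le (hopen : IsOpen Ω) (hfr : (frontier Ω).Nonempty)
    (hp : 1 < p) {u : Rd d → ℝ} (hu : Measurable u) {M : ℝ} (hM : ∀ x, |u x| ≤ M)
    (hfin : gagEnergy Ω s p α β u ≠ ⊤) {t₀ : ℝ} (ht₀ : 0 < t₀) {B : ℝ≥0∞} (hB : B ≠ ⊤)
    (hcut : ∀ t, 0 < t → 2 * t ≤ t₀ →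
      ∫⁻ z, ‖bdCutoff Ω t z.1 - bdCutoff Ω t z.2‖ₑ ^ p ∂gagMeasure Ω s p α β ≤ B)
    {ε : ℝ≥0∞} (hε : 0 < ε) (hεt : ε ≠ ⊤) :
    ∃ v : Rd d → ℝ, Measurable v ∧ (∀ x, |v x| ≤ M) ∧ (∀ x, u x = 0 → v x = 0) ∧
      (∃ δ > 0, ∀ x, distBd Ω x ≤ δ → v x = 0) ∧
      gagEnergy Ω s p α β v ≠ ⊤ ∧ gagEnergy Ω s p α β (fun x => u x - v x) ≤ ε := by
  have hp0 : 0 < p := by linarith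
  have h2p : (2 : ℝ≥0∞) ^ (p - 1) ≠ ⊤ := ENNReal.rpow_ne_top_of_nonneg (by linarith) (by simp)
  have hε2 : 0 < ε / 2 := ENNReal.half_pos hε.ne'
  obtain ⟨hfin1, hfin2⟩ := ENNReal.add_ne_top.1 hfin
  set t : ℕ → ℝ := fun n => t₀ / 2 / (n + 1) with ht
  have htpos : ∀ n, 0 < t n := fun n => by positivity
  have htle : ∀ n, 2 * t n ≤ t₀ := fun n => by
    have h1 : t₀ / 2 / (n + 1) ≤ t₀ / 2 := div_le_self (by positivity) (by
      linarith [n.cast_nonneg (α := ℝ)])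
    simp only [ht]; linarith
  have htanti : ∀ m n, m ≤ n → t n ≤ t m := fun m n hmn => by
    simp only [ht]
    gcongr
  have ht0 : Tendsto t atTop (nhds 0) :=
    tendsto_const_nhds.div_atTop (tendsto_natCast_atTop_atTop.atTop_add tendsto_const_nhds)
  have hev : ∀ x ∈ Ω, ∀ᶠ n in atTop, 2 * t n ≤ distBd Ω x := fun x hx => by
    have h : Tendsto (fun n => 2 * t n) atTop (nhds 0) := by simpa using ht0.const_mul 2
    exact h.eventually (ge_mem_nhds (distBd_pos hopen hfr hx))
  -- the `L^p` part
  have hlayer : ∀ n, MeasurableSet {x | distBd Ω x < 2 * t n} := fun n =>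
    measurableSet_lt (by fun_prop) (by fun_prop)
  have hLp := tendsto_lintegral_enorm_rpow_zero (μ := volume.restrict Ω) hp0 hfin1
    (G := fun n => {x | distBd Ω x < 2 * t n}.indicator u) (fun n => hu.indicator (hlayer n))
    (fun n x => by by_cases hx : x ∈ {x | distBd Ω x < 2 * t n} <;> simp [indicator, hx])
    (by
      filter_upwards [ae_restrict_mem hopen.measurableSet] with x hx
      filter_upwards [hev x hx] with n hn
      simp [indicator, not_lt.2 hn])
  obtain ⟨n₀, hn₀⟩ := (hLp.eventually (ge_mem_nhds hε2)).exists
  -- the sequence of remainders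
  set c : ℕ → Rd d → ℝ := fun n x => 1 - bdCutoff Ω (t n) x with hc
  have hc0 : ∀ n x, 0 ≤ c n x := fun n x => sub_nonneg.2 (bdCutoff_le_one _ _)
  have hc1 : ∀ n x, c n x ≤ 1 := fun n x => sub_le_self _ (bdCutoff_nonneg _ _)
  have hcm : ∀ n, Measurable (c n) := fun n => by fun_prop
  have hcz : ∀ n x, 2 * t n ≤ distBd Ω x → c n x = 0 := fun n x hx => by
    simp only [hc]
    rw [bdCutoff_eq_one (htpos n) hx, sub_self]
  set F : ℕ → Rd d × Rd d → ℝ := fun n z => u z.1 * c n z.1 - u z.2 * c n z.2 with hF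
  have hFB : ∀ n, ∫⁻ z, ‖F n z‖ₑ ^ p ∂gagMeasure Ω s p α β
      ≤ 2 ^ (p - 1) * (gagEnergy Ω s p α β u + ‖M‖ₑ ^ p * B) := by
    intro n
    refine (lintegral_enorm_rpow_add_le (μ := gagMeasure Ω s p α β) hp.le
      (u := fun z => u z.1 - u z.2)
      (v := fun z => M * (bdCutoff Ω (t n) z.1 - bdCutoff Ω (t n) z.2)) (by fun_prop)
      (fun z => ?_)).trans ?_
    · have e : F n z = (u z.1 - u z.2) * c n z.1
          + (-u z.2) * (bdCutoff Ω (t n) z.1 - bdCutoff Ω (t n) z.2) := by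
        simp only [hF, hc]; ring
      rw [e]
      refine (abs_add_le _ _).trans (add_le_add ?_ ?_)
      · rw [abs_mul, abs_of_nonneg (hc0 n _)]
        exact mul_le_of_le_one_right (abs_nonneg _) (hc1 n _)
      · rw [abs_mul, abs_mul, abs_neg]
        exact mul_le_mul_of_nonneg_right ((hM _).trans (le_abs_self _)) (abs_nonneg _)
    · gcongr
      · exact le_add_self
      · simp only [enorm_mul, ENNReal.mul_rpow_of_nonneg _ _ hp0.le]
        rw [lintegral_const_mul _ (by fun_prop)]
        gcongr
        exact hcut _ (htpos n) (htle n)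
  set A : ℕ → Set (Rd d × Rd d) := fun n =>
    {z | distBd Ω z.1 < 2 * t n} ∪ {z | distBd Ω z.2 < 2 * t n} with hA
  have hAm : ∀ n, MeasurableSet (A n) := fun n =>
    (measurableSet_lt (by fun_prop) (by fun_prop)).union
      (measurableSet_lt (by fun_prop) (by fun_prop))
  have hnA : ∀ n z, z ∉ A n ↔ 2 * t n ≤ distBd Ω z.1 ∧ 2 * t n ≤ distBd Ω z.2 := fun n z => by
    simp [hA]
  set B' := 2 ^ (p - 1) * (gagEnergy Ω s p α β u + ‖M‖ₑ ^ p * B) with hB'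
  have hB't : B' ≠ ⊤ := by
    have : ‖M‖ₑ ^ p ≠ ⊤ := ENNReal.rpow_ne_top_of_nonneg hp0.le enorm_ne_top
    finiteness
  set C := (2 : ℝ≥0∞) ^ (p - 1) * (1 + B') with hCdef
  have hC : C ≠ ⊤ := by finiteness
  have hK : Tendsto (fun K : ℕ => ENNReal.ofReal ((K : ℝ) ^ (-(p - 1))) * C) atTop (nhds 0) := by
    have h1 := ENNReal.tendsto_ofReal
      ((tendsto_rpow_neg_atTop (by linarith : 0 < p - 1)).comp tendsto_natCast_atTop_atTop)
    simpa using ENNReal.Tendsto.mul_const h1 (Or.inr hC)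
  obtain ⟨K, hKε, hK1⟩ := ((hK.eventually (ge_mem_nhds hε2)).and (eventually_ge_atTop 1)).exists
  have hK0 : (0 : ℝ) < K := by exact_mod_cast hK1
  obtain ⟨n, hn, hsum⟩ := exists_sparse_sum_le (μ := gagMeasure Ω s p α β) hp.le
    (F := F) (A := A) (fun n => by fun_prop) hAm hB't hFB
    (fun n z hz => by
      obtain ⟨h1, h2⟩ := (hnA n z).1 hz
      simp [hF, hcz n _ h1, hcz n _ h2])
    (by
      filter_upwards [ae_gagMeasure_mem hopen] with z hz
      filter_upwards [hev _ hz.1, hev _ hz.2] with n h1 h2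
      exact (hnA n z).2 ⟨h1, h2⟩) n₀ K
  set a : Rd d → ℝ := fun x => (K : ℝ)⁻¹ * ∑ k ∈ Finset.range K, c (n k) x with ha
  have ham : Measurable a := by fun_prop
  have ha0 : ∀ x, 0 ≤ a x := fun x =>
    mul_nonneg (by positivity) (Finset.sum_nonneg fun k _ => hc0 _ _)
  have ha1 : ∀ x, a x ≤ 1 := fun x => by
    have : ∑ k ∈ Finset.range K, c (n k) x ≤ K := by
      simpa using Finset.sum_le_sum (s := Finset.range K) fun k _ => hc1 (n k) x
    simp only [ha]
    rw [inv_mul_le_iff₀ hK0]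
    linarith
  have hw : gagEnergy Ω s p α β (fun x => u x * a x) ≤ ε := by
    rw [← ENNReal.add_halves ε]
    refine add_le_add (le_trans (lintegral_mono fun x => ?_) hn₀) ?_
    · refine ENNReal.rpow_le_rpow ?_ hp0.le
      rw [← ofReal_norm, ← ofReal_norm]
      refine ENNReal.ofReal_le_ofReal ?_
      by_cases hx : distBd Ω x < 2 * t n₀
      · simp only [indicator, mem_ofPred_eq, hx, if_true, norm_mul]
        refine mul_le_of_le_one_right (norm_nonneg _) ?_
        rw [Real.norm_eq_abs, abs_of_nonneg (ha0 x)]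
        exact ha1 x
      · have : a x = 0 := by
          simp only [ha]
          rw [Finset.sum_eq_zero, mul_zero]
          intro k _
          refine hcz _ _ (le_trans ?_ (not_lt.1 hx))
          linarith [htanti _ _ (hn k)]
        simp [this]
    · have e : ∀ z : Rd d × Rd d, u z.1 * a z.1 - u z.2 * a z.2
          = (K : ℝ)⁻¹ * ∑ k ∈ Finset.range K, F (n k) z := fun z => by
        simp only [ha, hF, Finset.sum_sub_distrib, ← Finset.mul_sum]
        ring
      simp only [e, enorm_mul, ENNReal.mul_rpow_of_nonneg _ _ hp0.le]
      rw [lintegral_const_mul _ (by fun_prop)]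
      refine le_trans (mul_le_mul_right hsum _) (le_trans (le_of_eq ?_) hKε)
      rw [← mul_assoc, ← ofReal_norm, ENNReal.ofReal_rpow_of_nonneg (norm_nonneg _) hp0.le,
        ← ENNReal.ofReal_natCast, ← ENNReal.ofReal_mul (by positivity), Real.norm_eq_abs,
        abs_of_pos (by positivity), Real.inv_rpow hK0.le, ← Real.rpow_neg hK0.le]
      congr 2
      nth_rw 2 [← Real.rpow_one (K : ℝ)]
      rw [← Real.rpow_add hK0]
      congr 1
      ring
  refine ⟨fun x => u x - u x * a x, by fun_prop, fun x => ?_, fun x hx => by simp [hx], ?_, ?_, ?_⟩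
  · have e : u x - u x * a x = u x * (1 - a x) := by ring
    simp only [e, abs_mul]
    rw [abs_of_nonneg (sub_nonneg.2 (ha1 x))]
    exact (mul_le_of_le_one_right (abs_nonneg _) (by linarith [ha0 x])).trans (hM x)
  · set N := (Finset.range K).sup n with hN
    refine ⟨t N, htpos N, fun x hx => ?_⟩
    have : ∑ k ∈ Finset.range K, c (n k) x = K := by
      rw [Finset.sum_congr rfl (g := fun _ => 1), Finset.sum_const]
      · simp
      · intro k hk
        simp only [hc]
        rw [bdCutoff_eq_zero (htpos _) (hx.trans (htanti _ _ (Finset.le_sup hk))), sub_zero]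
    have ha' : a x = 1 := by
      simp only [ha, this]
      exact inv_mul_cancel₀ hK0.ne'
    simp [ha']
  · refine ne_top_of_le_ne_top ?_ (gagEnergy_sub_le hp.le hu)
    exact ENNReal.mul_ne_top h2p (ENNReal.add_ne_top.2 ⟨hfin, ne_top_of_le_ne_top hεt hw⟩)
  · simpa using hw

end Support

/-! ### Comparison with an unweighted local energy -/

section Local

variable {d : ℕ} {Ω : Set (Rd d)} {s p α β : ℝ}

/-- The fractional kernel restricted to the ball of radius `δ`. -/
noncomputable def locKernel (s p δ : ℝ) (k : Rd d) : ℝ :=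
  if ‖k‖ < δ then (‖k‖ ^ ((d : ℝ) + s * p))⁻¹ else 0

@[fun_prop]
theorem measurable_locKernel {δ : ℝ} : Measurable (locKernel (d := d) s p δ) := by
  unfold locKernel
  exact Measurable.ite (measurableSet_lt (by fun_prop) (by fun_prop)) (by fun_prop) (by fun_prop)

theorem locKernel_nonneg (δ : ℝ) (k : Rd d) : 0 ≤ locKernel s p δ k := by
  unfold locKernel
  split_ifs <;> positivity

theorem enorm_rpow_eq_ofReal (hp : 0 ≤ p) (a : ℝ) : ‖a‖ₑ ^ p = ENNReal.ofReal (|a| ^ p) := by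
  rw [← ofReal_norm, Real.norm_eq_abs, ENNReal.ofReal_rpow_of_nonneg (abs_nonneg _) hp]

/-- The unweighted local energy in terms of increments. -/
theorem lintegral_locKernel_sub (hp : 0 < p) {u : Rd d → ℝ} (hu : Measurable u) (δ : ℝ) :
    ∫⁻ z : Rd d × Rd d, ENNReal.ofReal (locKernel s p δ (z.2 - z.1)) * ‖u z.2 - u z.1‖ₑ ^ p
      = ∫⁻ z : Rd d × Rd d, ‖(u (z.1 + z.2) - u z.1) * locKernel s p δ z.2 ^ (1 / p)‖ₑ ^ p := by
  rw [Measure.volume_eq_prod, lintegral_prod _ (by fun_prop), lintegral_prod _ (by fun_prop)]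
  refine lintegral_congr fun x => ?_
  rw [← lintegral_add_left_eq_self _ x]
  refine lintegral_congr fun k => ?_
  have h : (locKernel s p δ k ^ (1 / p)) ^ p = locKernel s p δ k := by
    rw [← Real.rpow_mul (locKernel_nonneg _ _), one_div_mul_cancel hp.ne', Real.rpow_one]
  rw [enorm_mul, ENNReal.mul_rpow_of_nonneg _ _ hp.le, enorm_rpow_eq_ofReal hp.le (_ ^ _),
    abs_of_nonneg (Real.rpow_nonneg (locKernel_nonneg _ _) _), h, mul_comm, add_sub_cancel_left]

theorem abs_sub_rpow_le (hp : 1 ≤ p) (a b : ℝ) :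
    |a - b| ^ p ≤ 2 ^ (p - 1) * (|a| ^ p + |b| ^ p) :=
  (Real.rpow_le_rpow (abs_nonneg _) (abs_sub a b) (by linarith)).trans
    (by exact_mod_cast NNReal.rpow_add_le_mul_rpow_add_rpow ‖a‖₊ ‖b‖₊ hp)

/-- If the support of `u` stays away from the boundary, its energy is controlled by the `L^p` norm
and by the unweighted local energy. -/
theorem gagEnergy_le_of_support (hs : 0 < s) (hp : 1 ≤ p) (hα : 0 ≤ α) (hβ : 0 ≤ β)
    {u : Rd d → ℝ} (hu : Measurable u) {c δ : ℝ} (hc : 0 < c) (hδ : 0 < δ)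
    (hK : ∀ x y, u x ≠ 0 → dist x y < δ → c ≤ distBd Ω y) :
    gagEnergy Ω s p α β u ≤
      (1 + ENNReal.ofReal (2 ^ (p - 1) * (δ ^ ((d : ℝ) + s * p))⁻¹) *
        (ENNReal.ofReal (c ^ (-α)) * (∫⁻ x in Ω, ENNReal.ofReal (distBd Ω x ^ (-β)))
          + ENNReal.ofReal (c ^ (-β)) * (∫⁻ x in Ω, ENNReal.ofReal (distBd Ω x ^ (-α)))))
        * (∫⁻ x, ‖u x‖ₑ ^ p)
      + ENNReal.ofReal (c ^ (-β) * c ^ (-α)) *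
        ∫⁻ z : Rd d × Rd d, ‖(u (z.1 + z.2) - u z.1) * locKernel s p δ z.2 ^ (1 / p)‖ₑ ^ p := by
  have hp0 : 0 < p := by linarith
  have hsp : 0 < s * p := by positivity
  have hdp : 0 < (d : ℝ) + s * p := by positivity
  have hcd : ∀ a : ℝ, 0 ≤ a → ∀ y, c ≤ distBd Ω y → distBd Ω y ^ (-a) ≤ c ^ (-a) :=
    fun a ha y hy => Real.rpow_le_rpow_of_nonpos hc hy (by linarith)
  have hself : ∀ x, u x ≠ 0 → c ≤ distBd Ω x := fun x hx => hK x x hx (by simpa using hδ)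
  set D := (δ ^ ((d : ℝ) + s * p))⁻¹ with hD
  have hD0 : 0 ≤ D := by positivity
  have hpt : ∀ z : Rd d × Rd d, gagWeight Ω s p α β z * ‖u z.1 - u z.2‖ₑ ^ p ≤
      ENNReal.ofReal (c ^ (-β) * c ^ (-α)) *
        (ENNReal.ofReal (locKernel s p δ (z.2 - z.1)) * ‖u z.2 - u z.1‖ₑ ^ p)
      + ENNReal.ofReal (2 ^ (p - 1) * D) *
        (ENNReal.ofReal (c ^ (-α)) * (‖u z.1‖ₑ ^ p * ENNReal.ofReal (distBd Ω z.2 ^ (-β)))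
          + ENNReal.ofReal (c ^ (-β)) *
            (ENNReal.ofReal (distBd Ω z.1 ^ (-α)) * ‖u z.2‖ₑ ^ p)) := by
    rintro ⟨x, y⟩
    have hb := Real.rpow_nonneg (distBd_nonneg (Ω := Ω) y) (-β)
    have ha := Real.rpow_nonneg (distBd_nonneg (Ω := Ω) x) (-α)
    simp only [enorm_rpow_eq_ofReal hp0.le, gagWeight]
    rcases lt_or_ge (dist x y) δ with hxy | hxy
    · refine le_add_right ?_
      rw [← ENNReal.ofReal_mul (by positivity), ← ENNReal.ofReal_mul (locKernel_nonneg _ _),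
        ← ENNReal.ofReal_mul (by positivity)]
      refine ENNReal.ofReal_le_ofReal ?_
      rw [locKernel, ← dist_eq_norm, dist_comm y x, if_pos hxy, abs_sub_comm (u y)]
      by_cases hu0 : u x = u y
      · simp [hu0, hp0.ne']
      have hcc : c ≤ distBd Ω x ∧ c ≤ distBd Ω y := by
        by_cases hx : u x = 0
        · have hy : u y ≠ 0 := fun h => hu0 (hx.trans h.symm)
          exact ⟨hK y x hy (by rwa [dist_comm]), hself y hy⟩
        · exact ⟨hself x hx, hK x y hx hxy⟩
      have h1 : distBd Ω y ^ (-β) * distBd Ω x ^ (-α) ≤ c ^ (-β) * c ^ (-α) :=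
        mul_le_mul (hcd β hβ y hcc.2) (hcd α hα x hcc.1) ha (by positivity)
      have h2 : 0 ≤ (dist x y ^ ((d : ℝ) + s * p))⁻¹ * |u x - u y| ^ p := by positivity
      nlinarith [mul_le_mul_of_nonneg_right h1 h2]
    · refine le_add_left ?_
      rw [← ENNReal.ofReal_mul (by positivity), ← ENNReal.ofReal_mul (by positivity),
        ← ENNReal.ofReal_mul ha, ← ENNReal.ofReal_mul (by positivity),
        ← ENNReal.ofReal_mul (by positivity), ← ENNReal.ofReal_add (by positivity) (by positivity),
        ← ENNReal.ofReal_mul (by positivity)]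
      refine ENNReal.ofReal_le_ofReal ?_
      have hd : (dist x y ^ ((d : ℝ) + s * p))⁻¹ ≤ D :=
        inv_anti₀ (by positivity) (Real.rpow_le_rpow hδ.le hxy hdp.le)
      have hux : |u x| ^ p * distBd Ω x ^ (-α) ≤ |u x| ^ p * c ^ (-α) := by
        by_cases hx : u x = 0
        · simp [hx, hp0.ne']
        · exact mul_le_mul_of_nonneg_left (hcd α hα x (hself x hx)) (by positivity)
      have huy : |u y| ^ p * distBd Ω y ^ (-β) ≤ |u y| ^ p * c ^ (-β) := by
        by_cases hy : u y = 0
        · simp [hy, hp0.ne']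
        · exact mul_le_mul_of_nonneg_left (hcd β hβ y (hself y hy)) (by positivity)
      calc (dist x y ^ ((d : ℝ) + s * p))⁻¹ * distBd Ω y ^ (-β) * distBd Ω x ^ (-α)
            * |u x - u y| ^ p
          ≤ D * distBd Ω y ^ (-β) * distBd Ω x ^ (-α)
            * (2 ^ (p - 1) * (|u x| ^ p + |u y| ^ p)) := by
            gcongr
            exact abs_sub_rpow_le hp _ _
        _ = 2 ^ (p - 1) * D * ((|u x| ^ p * distBd Ω x ^ (-α)) * distBd Ω y ^ (-β)
            + (|u y| ^ p * distBd Ω y ^ (-β)) * distBd Ω x ^ (-α)) := by ring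
        _ ≤ 2 ^ (p - 1) * D * ((|u x| ^ p * c ^ (-α)) * distBd Ω y ^ (-β)
            + (|u y| ^ p * c ^ (-β)) * distBd Ω x ^ (-α)) := by gcongr
        _ = _ := by ring
  have hU : ∫⁻ x in Ω, ‖u x‖ₑ ^ p ≤ ∫⁻ x, ‖u x‖ₑ ^ p := setLIntegral_le_lintegral _ _
  have hfar1 : ∫⁻ z in Ω ×ˢ Ω, ‖u z.1‖ₑ ^ p * ENNReal.ofReal (distBd Ω z.2 ^ (-β))
      ≤ (∫⁻ x in Ω, ENNReal.ofReal (distBd Ω x ^ (-β))) * ∫⁻ x, ‖u x‖ₑ ^ p := by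
    rw [Measure.volume_eq_prod, ← Measure.prod_restrict,
      lintegral_prod_mul (f := fun x => ‖u x‖ₑ ^ p) (g := fun y => ENNReal.ofReal (distBd Ω y ^ (-β)))
        (by fun_prop) (by fun_prop), mul_comm]
    gcongr
  have hfar2 : ∫⁻ z in Ω ×ˢ Ω, ENNReal.ofReal (distBd Ω z.1 ^ (-α)) * ‖u z.2‖ₑ ^ p
      ≤ (∫⁻ x in Ω, ENNReal.ofReal (distBd Ω x ^ (-α))) * ∫⁻ x, ‖u x‖ₑ ^ p := by
    rw [Measure.volume_eq_prod, ← Measure.prod_restrict,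
      lintegral_prod_mul (g := fun x => ‖u x‖ₑ ^ p) (f := fun y => ENNReal.ofReal (distBd Ω y ^ (-α)))
        (by fun_prop) (by fun_prop)]
    gcongr
  have hsemi : ∫⁻ z, ‖u z.1 - u z.2‖ₑ ^ p ∂gagMeasure Ω s p α β ≤
      ENNReal.ofReal (c ^ (-β) * c ^ (-α)) * (∫⁻ z : Rd d × Rd d,
        ENNReal.ofReal (locKernel s p δ (z.2 - z.1)) * ‖u z.2 - u z.1‖ₑ ^ p)
      + ENNReal.ofReal (2 ^ (p - 1) * D) *
        (ENNReal.ofReal (c ^ (-α)) *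
          ((∫⁻ x in Ω, ENNReal.ofReal (distBd Ω x ^ (-β))) * ∫⁻ x, ‖u x‖ₑ ^ p)
        + ENNReal.ofReal (c ^ (-β)) *
          ((∫⁻ x in Ω, ENNReal.ofReal (distBd Ω x ^ (-α))) * ∫⁻ x, ‖u x‖ₑ ^ p)) := by
    rw [lintegral_gagMeasure (by fun_prop)]
    refine (lintegral_mono hpt).trans ?_
    rw [lintegral_add_left (by fun_prop), lintegral_const_mul _ (by fun_prop),
      lintegral_const_mul _ (by fun_prop), lintegral_add_left (by fun_prop),
      lintegral_const_mul _ (by fun_prop), lintegral_const_mul _ (by fun_prop)]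
    refine add_le_add (mul_le_mul_right (setLIntegral_le_lintegral _ _) _)
      (mul_le_mul_right (add_le_add (mul_le_mul_right hfar1 _) (mul_le_mul_right hfar2 _)) _)
  refine (add_le_add hU hsemi).trans (le_of_eq ?_)
  rw [lintegral_locKernel_sub hp0 hu]
  ring

/-- If the support of `v` stays away from the complement of the bounded set `Ω`, its unweighted
local energy is controlled by its weighted energy. -/
theorem lintegral_locKernel_ne_top (hopen : IsOpen Ω) (hfr : (frontier Ω).Nonempty)
    (hbdd : Bornology.IsBounded Ω) (hp : 0 < p) (hα : 0 ≤ α) (hβ : 0 ≤ β)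
    {v : Rd d → ℝ} (hv : Measurable v) (hfin : gagEnergy Ω s p α β v ≠ ⊤) {δ : ℝ} (hδ : 0 < δ)
    (hK : ∀ x y, v x ≠ 0 → dist x y < δ → y ∈ Ω) :
    ∫⁻ z : Rd d × Rd d, ‖(v (z.1 + z.2) - v z.1) * locKernel s p δ z.2 ^ (1 / p)‖ₑ ^ p ≠ ⊤ := by
  obtain ⟨D, hD⟩ : ∃ D, ∀ x ∈ Ω, distBd Ω x ≤ D := by
    obtain ⟨D, hD⟩ := hbdd.isCompact_closure.bddAbove_image
      (continuous_distBd (Ω := Ω)).continuousOn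
    exact ⟨D, fun x hx => hD ⟨x, subset_closure hx, rfl⟩⟩
  rw [← lintegral_locKernel_sub hp hv]
  have hpt : ∀ z : Rd d × Rd d,
      ENNReal.ofReal (locKernel s p δ (z.2 - z.1)) * ‖v z.2 - v z.1‖ₑ ^ p ≤
      ENNReal.ofReal (D ^ β * D ^ α) * (Ω ×ˢ Ω).indicator
        (fun z => gagWeight Ω s p α β z * ‖v z.1 - v z.2‖ₑ ^ p) z := by
    rintro ⟨x, y⟩
    by_cases hxy : ‖y - x‖ < δ
    swap
    · simp [locKernel, hxy]
    by_cases h0 : v x = v y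
    · simp [h0, hp]
    have hd : dist x y < δ := by rwa [dist_comm, dist_eq_norm]
    have hmem : x ∈ Ω ∧ y ∈ Ω := by
      by_cases hx : v x = 0
      · have hy : v y ≠ 0 := fun h => h0 (hx.trans h.symm)
        exact ⟨hK y x hy (by rwa [dist_comm]), hK y y hy (by simpa using hδ)⟩
      · exact ⟨hK x x hx (by simpa using hδ), hK x y hx hd⟩
    have hx0 := distBd_pos hopen hfr hmem.1
    have hy0 := distBd_pos hopen hfr hmem.2
    have hxD := hD x hmem.1
    have hyD := hD y hmem.2
    have hD0 : 0 < D := hx0.trans_le hxD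
    rw [indicator_of_mem (show (x, y) ∈ Ω ×ˢ Ω from hmem)]
    simp only [enorm_rpow_eq_ofReal hp.le, gagWeight]
    rw [← ENNReal.ofReal_mul (locKernel_nonneg _ _), ← ENNReal.ofReal_mul (by positivity),
      ← ENNReal.ofReal_mul (by positivity)]
    refine ENNReal.ofReal_le_ofReal ?_
    rw [locKernel, if_pos hxy, abs_sub_comm (v y), dist_comm x y, dist_eq_norm]
    have h1 : 1 ≤ D ^ β * distBd Ω y ^ (-β) := by
      rw [Real.rpow_neg hy0.le, ← div_eq_mul_inv, one_le_div (by positivity)]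
      gcongr
    have h2 : 1 ≤ D ^ α * distBd Ω x ^ (-α) := by
      rw [Real.rpow_neg hx0.le, ← div_eq_mul_inv, one_le_div (by positivity)]
      gcongr
    have h3 : 0 ≤ (‖y - x‖ ^ ((d : ℝ) + s * p))⁻¹ * |v x - v y| ^ p := by positivity
    nlinarith [mul_le_mul_of_nonneg_left (one_le_mul_of_one_le_of_one_le h1 h2) h3]
  refine ne_top_of_le_ne_top ?_ (lintegral_mono hpt)
  rw [lintegral_const_mul' _ _ ENNReal.ofReal_ne_top,
    lintegral_indicator (hopen.measurableSet.prod hopen.measurableSet),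
    ← lintegral_gagMeasure (by fun_prop)]
  exact ENNReal.mul_ne_top ENNReal.ofReal_ne_top (ENNReal.add_ne_top.1 hfin).2

end Local

/-! ### Mollification -/

section Mollify

variable {d : ℕ} {Ω : Set (Rd d)} {s p α β : ℝ}

/-- There are probability measures concentrated near the origin averaging against which smooths
bounded functions. -/
theorem exists_smoothing_measure {r : ℝ} (hr : 0 < r) :
    ∃ P : Measure (Rd d), IsProbabilityMeasure P ∧ P (closedBall 0 r)ᶜ = 0 ∧
      ∀ v : Rd d → ℝ, Measurable v → (∃ M, ∀ x, |v x| ≤ M) →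
        ContDiff ℝ (⊤ : ℕ∞) fun x => ∫ z, v (x + -z) ∂P := by
  let η : ContDiffBump (0 : Rd d) := ⟨r / 2, r, by positivity, by linarith⟩
  have hη : Continuous (η.normed volume) := η.continuous_normed
  have hηm : Measurable fun z => ENNReal.ofReal (η.normed volume z) :=
    hη.measurable.ennreal_ofReal
  refine ⟨volume.withDensity fun z => ENNReal.ofReal (η.normed volume z), ⟨?_⟩, ?_, ?_⟩
  · rw [withDensity_apply _ MeasurableSet.univ, Measure.restrict_univ,
      ← ofReal_integral_eq_lintegral_ofReal η.integrable_normed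
        (Eventually.of_forall η.nonneg_normed), η.integral_normed, ENNReal.ofReal_one]
  · rw [withDensity_apply _ isClosed_closedBall.measurableSet.compl]
    refine setLIntegral_eq_zero isClosed_closedBall.measurableSet.compl fun z hz => ?_
    have : η.normed volume z = 0 := by
      by_contra h
      have hz' : z ∈ Function.support (η.normed volume) := h
      rw [η.support_normed_eq] at hz'
      exact hz (ball_subset_closedBall hz')
    simp [this]
  · rintro v hv ⟨M, hM⟩
    have hloc : LocallyIntegrable v volume :=
      (locallyIntegrable_const M).mono hv.aestronglyMeasurable
        (Eventually.of_forall fun x => (hM x).trans (le_abs_self M))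
    have h := (η.hasCompactSupport_normed (μ := volume)).contDiff_convolution_left (n := (⊤ : ℕ∞))
      (μ := volume) (ContinuousLinearMap.lsmul ℝ ℝ) η.contDiff_normed hloc
    convert h using 1
    ext x
    rw [integral_withDensity_eq_integral_toReal_smul hηm (by simp), convolution_def]
    refine integral_congr_ae (Eventually.of_forall fun z => ?_)
    simp [ENNReal.toReal_ofReal (η.nonneg_normed z), sub_eq_add_neg]

/-- Bounded functions of finite energy supported in a compact subset of `Ω` are approximated by
test functions. -/
theorem exists_contDiff_gagEnergy_sub_le (hopen : IsOpen Ω) (hfr : (frontier Ω).Nonempty)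
    (hbdd : Bornology.IsBounded Ω) (hs : 0 < s) (hp : 1 ≤ p) (hα : 0 ≤ α) (hβ : 0 ≤ β)
    (hIα : ∫⁻ x in Ω, ENNReal.ofReal (distBd Ω x ^ (-α)) ≠ ⊤)
    (hIβ : ∫⁻ x in Ω, ENNReal.ofReal (distBd Ω x ^ (-β)) ≠ ⊤)
    {v : Rd d → ℝ} (hv : Measurable v) {M : ℝ} (hM : ∀ x, |v x| ≤ M)
    {K : Set (Rd d)} (hKc : IsCompact K) (hKΩ : K ⊆ Ω) (hvK : ∀ x, v x ≠ 0 → x ∈ K)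
    (hfin : gagEnergy Ω s p α β v ≠ ⊤) {ε : ℝ≥0∞} (hε : 0 < ε) :
    ∃ φ : Rd d → ℝ, ContDiff ℝ (⊤ : ℕ∞) φ ∧ HasCompactSupport φ ∧ tsupport φ ⊆ Ω ∧
      gagEnergy Ω s p α β (fun x => v x - φ x) ≤ ε := by
  have hp0 : 0 < p := by linarith
  obtain ⟨δ₀, hδ₀, hsub⟩ := hKc.exists_cthickening_subset_open hopen hKΩ
  set δ := δ₀ / 2 with hδdef
  have hδ : 0 < δ := by positivity
  obtain ⟨c, hc, hcK⟩ : ∃ c > 0, ∀ x ∈ cthickening δ₀ K, c ≤ distBd Ω x := by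
    rcases (cthickening δ₀ K).eq_empty_or_nonempty with he | hne
    · exact ⟨1, one_pos, by simp [he]⟩
    · obtain ⟨x, hx, hmin⟩ := hKc.cthickening.exists_isMinOn hne
        (continuous_distBd (Ω := Ω)).continuousOn
      exact ⟨_, distBd_pos hopen hfr (hsub hx), fun y hy => hmin hy⟩
  have hthick : ∀ x y a b, x ∈ cthickening a K → dist x y ≤ b → 0 ≤ a → 0 ≤ b → a + b ≤ δ₀ →
      y ∈ cthickening δ₀ K := fun x y a b hx hxy ha hb hab =>
    cthickening_mono hab _ (add_comm b a ▸ cthickening_cthickening_subset hb ha K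
      (mem_cthickening_of_dist_le y x b _ hx (by rwa [dist_comm])))
  -- finiteness of the energies to be approximated
  set A := 1 + ENNReal.ofReal (2 ^ (p - 1) * (δ ^ ((d : ℝ) + s * p))⁻¹) *
    (ENNReal.ofReal (c ^ (-α)) * (∫⁻ x in Ω, ENNReal.ofReal (distBd Ω x ^ (-β)))
      + ENNReal.ofReal (c ^ (-β)) * (∫⁻ x in Ω, ENNReal.ofReal (distBd Ω x ^ (-α)))) with hA
  have hAt : A ≠ ⊤ := by finiteness
  set A' := ENNReal.ofReal (c ^ (-β) * c ^ (-α)) with hA'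
  set G : Rd d × Rd d → ℝ := fun z => (v (z.1 + z.2) - v z.1) * locKernel s p δ z.2 ^ (1 / p)
    with hG
  have hGm : Measurable G := by fun_prop
  have hGfin : ∫⁻ z, ‖G z‖ₑ ^ p ≠ ⊤ :=
    lintegral_locKernel_ne_top hopen hfr hbdd hp0 hα hβ hv hfin hδ fun x y hx hxy =>
      hsub (hthick x y 0 δ (self_subset_cthickening _ (hvK x hx)) hxy.le le_rfl hδ.le
        (by linarith))
  have hvfin : ∫⁻ x, ‖v x‖ₑ ^ p ≠ ⊤ := by
    have e : ∫⁻ x, ‖v x‖ₑ ^ p = ∫⁻ x in Ω, ‖v x‖ₑ ^ p := by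
      rw [← lintegral_indicator hopen.measurableSet]
      refine lintegral_congr fun x => ?_
      by_cases hx : x ∈ Ω
      · simp [hx]
      · have : v x = 0 := by_contra fun h => hx (hKΩ (hvK x h))
        simp [hx, this, hp0]
    rw [e]
    exact (ENNReal.add_ne_top.1 hfin).1
  obtain ⟨ε₁, hε₁, hε₁le⟩ : ∃ ε₁ : ℝ≥0∞, 0 < ε₁ ∧ A * ε₁ + A' * ε₁ ≤ ε := by
    have hAA : A + A' ≠ ⊤ := ENNReal.add_ne_top.2 ⟨hAt, ENNReal.ofReal_ne_top⟩
    refine ⟨ε / (A + A'), ENNReal.div_pos hε.ne' hAA, ?_⟩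
    rw [← add_mul]
    exact ENNReal.mul_div_le
  obtain ⟨r₁, hr₁, h1⟩ := exists_lintegral_average_translate_le (volume : Measure (Rd d)) hp hv
    hvfin (i := fun z : Rd d => -z) continuous_neg neg_zero hε₁
  obtain ⟨r₂, hr₂, h2⟩ := exists_lintegral_average_translate_le
    ((volume : Measure (Rd d)).prod (volume : Measure (Rd d))) hp hGm hGfin
    (i := fun z : Rd d => (-z, 0)) (by fun_prop) (by simp) hε₁
  set r := min δ (min r₁ r₂) with hr
  obtain ⟨P, hP, hPr, hPs⟩ := exists_smoothing_measure (d := d)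
    (show 0 < r from lt_min hδ (lt_min hr₁ hr₂))
  have hPmono : ∀ r', r ≤ r' → P (closedBall 0 r')ᶜ = 0 := fun r' hr' =>
    measure_mono_null (compl_subset_compl.2 (closedBall_subset_closedBall hr')) hPr
  set φ : Rd d → ℝ := fun x => ∫ z, v (x + -z) ∂P with hφ
  have hφs : ContDiff ℝ (⊤ : ℕ∞) φ := hPs v hv ⟨M, hM⟩
  have hφm : Measurable φ := hφs.continuous.measurable
  have hvint : ∀ x, Integrable (fun z => v (x + -z)) P := fun x =>
    (integrable_const M).mono (by fun_prop : Measurable _).aestronglyMeasurable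
      (Eventually.of_forall fun z => (hM _).trans (le_abs_self M))
  have hvint' : ∀ x, Integrable (fun z => v x - v (x + -z)) P := fun x =>
    (integrable_const _).sub (hvint x)
  have hφK : ∀ x, φ x ≠ 0 → x ∈ cthickening δ K := by
    intro x hx
    by_contra hxK
    refine hx (integral_eq_zero_of_ae ?_)
    have hae : ∀ᵐ z ∂P, z ∈ closedBall (0 : Rd d) δ := by
      rw [ae_iff]
      exact hPmono δ (min_le_left _ _)
    filter_upwards [hae] with z hz
    by_contra h
    refine hxK (mem_cthickening_of_dist_le x (x + -z) δ _ (hvK _ h) ?_)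
    simpa [dist_eq_norm] using hz
  have hts : tsupport φ ⊆ cthickening δ K :=
    closure_minimal (fun x hx => hφK x hx) isClosed_cthickening
  refine ⟨φ, hφs, hKc.cthickening.of_isClosed_subset (isClosed_tsupport _) hts,
    hts.trans ((cthickening_mono (by linarith) _).trans hsub), ?_⟩
  have hu : ∀ x, v x - φ x = ∫ z, (v x - v (x + -z)) ∂P := fun x => by
    rw [integral_sub (integrable_const _) (hvint x)]
    simp [hφ]
  have huK : ∀ x, v x - φ x ≠ 0 → x ∈ cthickening δ K := by
    intro x hx
    by_cases h : φ x = 0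
    · exact self_subset_cthickening _ (hvK x fun h' => hx (by rw [h, h', sub_zero]))
    · exact hφK x h
  refine (gagEnergy_le_of_support hs hp hα hβ (hv.sub hφm) hc hδ fun x y hx hxy =>
    hcK y (hthick x y δ δ (huK x hx) hxy.le hδ.le hδ.le (by linarith))).trans
      (le_trans (add_le_add (mul_le_mul_right ?_ _) (mul_le_mul_right ?_ _)) hε₁le)
  · simp only [Pi.sub_apply, hu]
    exact h1 P hP (hPmono _ ((min_le_right _ _).trans (min_le_left _ _)))
  · refine le_trans (le_of_eq (lintegral_congr fun z => ?_))
      (h2 P hP (hPmono _ ((min_le_right _ _).trans (min_le_right _ _))))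
    congr 2
    have e : ∀ w, G z - G (z + (-w, 0)) = ((v (z.1 + z.2) - v (z.1 + z.2 + -w))
        - (v z.1 - v (z.1 + -w))) * locKernel s p δ z.2 ^ (1 / p) := fun w => by
      simp only [hG, Prod.fst_add, Prod.snd_add, add_zero, add_right_comm z.1 (-w)]
      ring
    simp only [e, Pi.sub_apply, hu]
    rw [integral_mul_const, integral_sub (hvint' _) (hvint' _)]

end Mollify

/-! ### The density theorem -/

section Density

variable {d : ℕ} {Ω : Set (Rd d)} {s p α β : ℝ}

theorem gagP_congr_ae {f g : Rd d → ℝ} (h : f =ᵐ[volume.restrict Ω] g) :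
    gagP Ω s p α β f = gagP Ω s p α β g := by
  refine lintegral_congr_ae ?_
  filter_upwards [h] with x hx
  refine lintegral_congr_ae ?_
  filter_upwards [h] with y hy
  rw [hx, hy]

theorem wNorm_congr_ae {f g : Rd d → ℝ} (h : f =ᵐ[volume.restrict Ω] g) :
    wNorm Ω s p α β f = wNorm Ω s p α β g := by
  rw [wNorm, wNorm, gagSemi, gagSemi, gagP_congr_ae h, eLpNorm_congr_ae h]

theorem eLpNorm_ofReal_eq (hp : 0 < p) (u : Rd d → ℝ) :
    eLpNorm u (ENNReal.ofReal p) (volume.restrict Ω) = (∫⁻ x in Ω, ‖u x‖ₑ ^ p) ^ (1 / p) := by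
  rw [eLpNorm_eq_lintegral_rpow_enorm_toReal (by simpa using hp) ENNReal.ofReal_ne_top,
    ENNReal.toReal_ofReal hp.le]

theorem memW_iff_gagEnergy_ne_top (hp : 0 < p) {u : Rd d → ℝ} (hu : Measurable u) :
    memW Ω s p α β u ↔ gagEnergy Ω s p α β u ≠ ⊤ := by
  rw [memW, gagP_eq_lintegral hp hu, gagEnergy, ENNReal.add_ne_top, lt_top_iff_ne_top, MemLp,
    eLpNorm_ofReal_eq hp, and_iff_right hu.aestronglyMeasurable,
    ENNReal.rpow_lt_top_iff_of_pos (by positivity), lt_top_iff_ne_top]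

theorem wNorm_le_gagEnergy (hp : 0 < p) {u : Rd d → ℝ} (hu : Measurable u) :
    wNorm Ω s p α β u ≤ 2 * gagEnergy Ω s p α β u ^ (1 / p) := by
  rw [wNorm, gagSemi, gagP_eq_lintegral hp hu, eLpNorm_ofReal_eq hp, two_mul]
  have : 0 ≤ 1 / p := by positivity
  exact add_le_add (ENNReal.rpow_le_rpow le_self_add this) (ENNReal.rpow_le_rpow le_add_self this)

/-- Every measurable function of finite energy vanishing off `Ω` is approximated by test
functions in energy. -/
theorem exists_contDiff_gagEnergy_sub_le_of_isHomog (hne : Ω.Nonempty) (hopen : IsOpen Ω)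
    (hfr : (frontier Ω).Nonempty) (hbdd : Bornology.IsBounded Ω) (hs0 : 0 < s) (hs1 : s < 1)
    (hp : 1 < p) (hα : 0 ≤ α) (hβ : 0 ≤ β)
    (hhom : IsHomog ((d : ℝ) - (s * p + α + β)) (frontier Ω))
    {u : Rd d → ℝ} (hu : Measurable u) (hu0 : ∀ x ∉ Ω, u x = 0)
    (hfin : gagEnergy Ω s p α β u ≠ ⊤) {ε : ℝ≥0∞} (hε : 0 < ε) (hεt : ε ≠ ⊤) :
    ∃ φ : Rd d → ℝ, ContDiff ℝ (⊤ : ℕ∞) φ ∧ HasCompactSupport φ ∧ tsupport φ ⊆ Ω ∧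
      gagEnergy Ω s p α β (fun x => u x - φ x) ≤ ε := by
  have hp0 : 0 < p := by linarith
  have hsp : 0 < s * p := by positivity
  obtain ⟨C, hC, t₀, ht₀, hvol⟩ := exists_volume_layer_le hfr hbdd hhom
  obtain ⟨B, hB, hcut⟩ := exists_lintegral_bdCutoff_le hopen hne hfr hs0 hs1 hp0 hC hα hβ hvol
  have hIα := lintegral_distBd_rpow_ne_top hopen hfr hbdd hC ht₀ hα
    (by linarith : α < s * p + α + β) hvol
  have hIβ := lintegral_distBd_rpow_ne_top hopen hfr hbdd hC ht₀ hβ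
    (by linarith : β < s * p + α + β) hvol
  set T := (2 : ℝ≥0∞) ^ (p - 1) with hT
  have hT0 : T ≠ 0 := by simp [hT]
  have hTt : T ≠ ⊤ := ENNReal.rpow_ne_top_of_nonneg (by linarith) (by simp)
  set η := ε / (T * (1 + T * 2)) with hη
  have hTT : T * (1 + T * 2) ≠ ⊤ := by finiteness
  have hη0 : 0 < η := ENNReal.div_pos hε.ne' hTT
  have hηt : η ≠ ⊤ := ENNReal.div_ne_top hεt (by simp [hT0])
  obtain ⟨v, hv, ⟨M, hM⟩, hv0, hvfin, hvε⟩ := exists_bounded_gagEnergy_sub_le hp.le hu hfin hη0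
  obtain ⟨w, hw, hwM, hw0, ⟨δ, hδ, hwδ⟩, hwfin, hwε⟩ :=
    exists_supported_gagEnergy_sub_le hopen hfr hp hv hM hvfin ht₀ hB hcut hη0 hηt
  set K := closure Ω ∩ {x | δ ≤ distBd Ω x} with hK
  have hKc : IsCompact K :=
    hbdd.isCompact_closure.inter_right (isClosed_le continuous_const continuous_distBd)
  have hKΩ : K ⊆ Ω := by
    rintro x ⟨hx, hxδ⟩
    by_contra hxΩ
    have hxf : x ∈ frontier Ω := by
      rw [hopen.frontier_eq]
      exact ⟨hx, hxΩ⟩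
    have h0 : distBd Ω x = 0 := infDist_zero_of_mem hxf
    have hxδ' : δ ≤ distBd Ω x := hxδ
    linarith
  obtain ⟨φ, hφ, hφc, hφΩ, hφε⟩ := exists_contDiff_gagEnergy_sub_le hopen hfr hbdd hs0 hp.le hα hβ
    hIα hIβ hw hwM hKc hKΩ
    (fun x hx => by
      have hxΩ : x ∈ Ω := by_contra fun h => hx (hw0 x (hv0 x (hu0 x h)))
      exact ⟨subset_closure hxΩ, (not_le.1 fun h => hx (hwδ x h)).le⟩) hwfin hη0
  refine ⟨φ, hφ, hφc, hφΩ, ?_⟩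
  have h1 := gagEnergy_add_le (Ω := Ω) (s := s) (α := α) (β := β) hp.le
    (v := fun x => w x - φ x) (hv.sub hw)
  have h2 := gagEnergy_add_le (Ω := Ω) (s := s) (α := α) (β := β) hp.le
    (v := fun x => v x - φ x) (hu.sub hv)
  simp only [Pi.sub_apply, sub_add_sub_cancel] at h1 h2
  calc gagEnergy Ω s p α β (fun x => u x - φ x)
      ≤ T * (η + T * (η + η)) :=
        h2.trans (mul_le_mul_right (add_le_add hvε
          (h1.trans (mul_le_mul_right (add_le_add hwε hφε) _))) _)
    _ = T * (1 + T * 2) * η := by ring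
    _ ≤ ε := ENNReal.mul_div_le

end Density

/-- if `∂Ω` is `(d - sp - α - β)`-homogeneous, `p > 1` and
`sp + α + β = codim_A(∂Ω)`, then `W_0^{s,p;α,β}(Ω) = W^{s,p;α,β}(Ω)`. -/
theorem stmt4 {d : ℕ} (Ω : Set (Rd d)) (hne : Ω.Nonempty)
    (hopen : IsOpen Ω) (hbdd : Bornology.IsBounded Ω) (s p α β : ℝ)
    (hs0 : 0 < s) (hs1 : s < 1) (hp : 1 < p) (hα0 : 0 ≤ α) (hβ0 : 0 ≤ β)
    (hhom : IsHomog ((d : ℝ) - s * p - α - β) (frontier Ω))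
    (h : s * p + α + β = lowerCodimA (frontier Ω)) :
    ∀ f : Rd d → ℝ, memW Ω s p α β f ↔ memW0 Ω s p α β f := by
  have hp0 : 0 < p := by linarith
  have hsp : 0 < s * p := by positivity
  have hfr : (frontier Ω).Nonempty :=
    frontier_nonempty_of_lowerCodimA_pos (h ▸ by linarith)
  refine fun f => ⟨fun hf => ⟨hf, fun ε hε => ?_⟩, fun hf => hf.1⟩
  have hfm : AEMeasurable f (volume.restrict Ω) := hf.1.1.aemeasurable
  set u : Rd d → ℝ := Ω.indicator (hfm.mk f) with hu
  have hum : Measurable u := hfm.measurable_mk.indicator hopen.measurableSet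
  have hfu : f =ᵐ[volume.restrict Ω] u := by
    filter_upwards [hfm.ae_eq_mk, ae_restrict_mem hopen.measurableSet] with x hx hxΩ
    rw [hx, hu, indicator_of_mem hxΩ]
  have hufin : gagEnergy Ω s p α β u ≠ ⊤ :=
    (memW_iff_gagEnergy_ne_top hp0 hum).1
      ⟨hf.1.ae_eq hfu, gagP_congr_ae (s := s) (p := p) (α := α) (β := β) hfu ▸ hf.2⟩
  obtain ⟨φ, hφ, hφc, hφΩ, hφε⟩ := exists_contDiff_gagEnergy_sub_le_of_isHomog hne hopen hfr hbdd
    hs0 hs1 hp hα0 hβ0 (by simpa only [sub_sub, add_assoc] using hhom) hum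
    (fun x hx => indicator_of_notMem hx _) hufin
    (ε := ENNReal.ofReal ((ε / 3) ^ p)) (ENNReal.ofReal_pos.2 (by positivity))
    ENNReal.ofReal_ne_top
  have hφm : Measurable φ := hφ.continuous.measurable
  refine ⟨φ, hφ, hφc, hφΩ, (memW_iff_gagEnergy_ne_top hp0 hφm).2 ?_, ?_⟩
  · have h1 := gagEnergy_sub_le (Ω := Ω) (s := s) (α := α) (β := β) hp.le
      (v := fun x => u x - φ x) hum
    simp only [sub_sub_cancel] at h1
    exact ne_top_of_le_ne_top (ENNReal.mul_ne_top
      (ENNReal.rpow_ne_top_of_nonneg (by linarith) (by simp))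
      (ENNReal.add_ne_top.2 ⟨hufin, ne_top_of_le_ne_top ENNReal.ofReal_ne_top hφε⟩)) h1
  · rw [wNorm_congr_ae (g := fun x => u x - φ x) (by
      filter_upwards [hfu] with x hx
      rw [hx])]
    calc wNorm Ω s p α β (fun x => u x - φ x)
        ≤ 2 * ENNReal.ofReal ((ε / 3) ^ p) ^ (1 / p) :=
          (wNorm_le_gagEnergy hp0 (hum.sub hφm)).trans
            (mul_le_mul_right (ENNReal.rpow_le_rpow hφε (by positivity)) _)
      _ = ENNReal.ofReal (2 * (ε / 3)) := by
          rw [ENNReal.ofReal_rpow_of_nonneg (by positivity) (by positivity),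
            ← Real.rpow_mul (by positivity), mul_one_div_cancel hp0.ne', Real.rpow_one,
            ENNReal.ofReal_mul (by norm_num), ENNReal.ofReal_ofNat]
      _ < ENNReal.ofReal ε := (ENNReal.ofReal_lt_ofReal_iff hε).2 (by linarith)
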